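/- arXiv:2006.12561 — 2 statements merged into one kernel-verified Lean document; each statement's English description precedes it below -/
import Mathlib

section
/- Let G be a connected cubic graph (every vertex has degree exactly 3) on n vertices, with a nonnegative weight w(v) assigned to each vertex v. Then G has a spanning tree T such that the sum of the weights of the internal vertices of T is at least (3/4 − 3/n) times the total weight of all vertices of G. -/
open scoped Classical

/-- The total weight of internal vertices (degree at least 2) of a graph `T`. -/
noncomputable def internalWeight {V : Type*} [Fintype V] (T : SimpleGraph V) (w : V → ℝ) : ℝ :=
  ∑ v ∈ Finset.univ.filter (fun v => 2 ≤ T.degree v), w v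

/-- Reachability inside a vertex set `U`. -/
def ReachIn {V : Type*} (G : SimpleGraph V) (U : Finset V) : V → V → Prop :=
  Relation.ReflTransGen (fun a b => G.Adj a b ∧ a ∈ U ∧ b ∈ U)

theorem ReachIn.symm {V : Type*} {G : SimpleGraph V} {U : Finset V} {a b : V}
    (h : ReachIn G U a b) : ReachIn G U b a := by
  induction h with
  | refl => exact Relation.ReflTransGen.refl
  | tail _ hbc ih => exact Relation.ReflTransGen.head ⟨hbc.1.symm, hbc.2.2, hbc.2.1⟩ ih

/-- A depth-first-search tree of the vertex set `U` with root `r`; `par` is the parent function,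
`D u` the set of descendants of `u` (including `u`), and every child minimises the priority `p`. -/
structure IsDFS {V : Type*} (G : SimpleGraph V) (p : V → Finset V → V → ℕ)
    (U : Finset V) (r : V) (par : V → V) (D : V → Finset V) : Prop where
  root_mem : r ∈ U
  root : D r = U
  sub : ∀ u ∈ U, D u ⊆ U
  self : ∀ u ∈ U, u ∈ D u
  trans : ∀ u ∈ U, ∀ v ∈ U, u ∈ D v → D u ⊆ D v
  anti : ∀ u ∈ U, ∀ v ∈ U, u ∈ D v → v ∈ D u → u = v
  par_mem : ∀ u ∈ U, u ≠ r → par u ∈ U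
  par_adj : ∀ u ∈ U, u ≠ r → G.Adj (par u) u
  par_desc : ∀ u ∈ U, u ≠ r → u ∈ D (par u)
  up : ∀ u ∈ U, ∀ v ∈ U, u ∈ D v → u ≠ v → par u ∈ D v
  edge : ∀ u ∈ U, ∀ v ∈ U, G.Adj u v → u ∈ D v ∨ v ∈ D u
  rule : ∀ u ∈ U, u ≠ r → ∀ c ∈ D u, G.Adj (par u) c → p (par u) (D u) u ≤ p (par u) (D u) c

theorem exists_isDFS {V : Type*} [Fintype V] (G : SimpleGraph V) (p : V → Finset V → V → ℕ) :
    ∀ (n : ℕ) (U : Finset V) (r : V), U.card = n → r ∈ U → (∀ u ∈ U, ReachIn G U u r) →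
      ∃ par D, IsDFS G p U r par D := by
  intro n
  induction n using Nat.strong_induction_on with
  | _ n ih =>
  intro U r hcard hr hconn
  set U' := U.erase r with hU'
  set K : V → Finset V := fun u => U'.filter (fun x => ReachIn G U' u x) with hK
  have memK : ∀ u x, x ∈ K u ↔ x ∈ U' ∧ ReachIn G U' u x := by
    intro u x; simp [hK]
  have selfK : ∀ u ∈ U', u ∈ K u := fun u hu => (memK u u).2 ⟨hu, Relation.ReflTransGen.refl⟩
  have eqK : ∀ u x, x ∈ K u → K x = K u := by
    intro u x hx
    have h1 := ((memK u x).1 hx).2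
    ext z
    rw [memK, memK]
    constructor
    · rintro ⟨a, b⟩; exact ⟨a, Relation.ReflTransGen.trans h1 b⟩
    · rintro ⟨a, b⟩; exact ⟨a, Relation.ReflTransGen.trans (ReachIn.symm h1) b⟩
  have adjK : ∀ a b, a ∈ U' → b ∈ U' → G.Adj a b → b ∈ K a := by
    intro a b ha hb hab
    exact (memK a b).2 ⟨hb, Relation.ReflTransGen.single ⟨hab, ha, hb⟩⟩
  have nbrK : ∀ u ∈ U', ∃ c ∈ K u, G.Adj r c := by
    intro u hu
    have h := hconn u (Finset.mem_of_mem_erase hu)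
    revert hu
    induction h using Relation.ReflTransGen.head_induction_on with
    | refl => intro hu; simp [hU'] at hu
    | head hab hb ihb =>
      rename_i a b
      intro ha
      by_cases hbr : b = r
      · subst hbr; exact ⟨a, selfK a ha, hab.1.symm⟩
      · have hb' : b ∈ U' := Finset.mem_erase.2 ⟨hbr, hab.2.2⟩
        obtain ⟨c, hc, hc2⟩ := ihb hb'
        rw [eqK a b (adjK a b ha hb' hab.1)] at hc
        exact ⟨c, hc, hc2⟩
  have connK : ∀ u ∈ U', ∀ x ∈ K u, ReachIn G (K u) u x := by
    intro u hu x hx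
    have h := ((memK u x).1 hx).2
    clear hx
    induction h with
    | refl => exact Relation.ReflTransGen.refl
    | tail hab hbc ihb =>
      refine Relation.ReflTransGen.tail ihb ⟨hbc.1, (memK _ _).2 ⟨hbc.2.1, hab⟩, ?_⟩
      exact (memK _ _).2 ⟨hbc.2.2, Relation.ReflTransGen.tail hab hbc⟩
  have hsub : ∀ u, K u ⊆ U' := fun u => Finset.filter_subset _ _
  have key : ∀ S : Finset V, ∃ (c : V) (par : V → V) (D : V → Finset V), (∃ u ∈ U', S = K u) →
      (c ∈ S ∧ G.Adj r c ∧ (∀ c' ∈ S, G.Adj r c' → p r S c ≤ p r S c') ∧ IsDFS G p S c par D) := by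
    intro S
    by_cases hS : ∃ u ∈ U', S = K u
    · obtain ⟨u, hu, rfl⟩ := hS
      have hne : ((K u).filter (fun c => G.Adj r c)).Nonempty := by
        obtain ⟨c, hc, hc2⟩ := nbrK u hu
        exact ⟨c, Finset.mem_filter.2 ⟨hc, hc2⟩⟩
      obtain ⟨c, hc, hmin⟩ := Finset.exists_min_image _ (fun c => p r (K u) c) hne
      rw [Finset.mem_filter] at hc
      have hlt : (K u).card < n := by
        rw [← hcard]
        exact lt_of_le_of_lt (Finset.card_le_card (hsub u)) (Finset.card_erase_lt_of_mem hr)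
      obtain ⟨par, D, hD⟩ := ih _ hlt (K u) c rfl hc.1 (fun x hx =>
        Relation.ReflTransGen.trans (ReachIn.symm (connK u hu x hx)) (connK u hu c hc.1))
      exact ⟨c, par, D, fun _ => ⟨hc.1, hc.2, fun c' h1 h2 =>
        hmin c' (Finset.mem_filter.2 ⟨h1, h2⟩), hD⟩⟩
    · exact ⟨r, fun _ => r, fun _ => ∅, fun h => absurd h hS⟩
  choose c par D hkey using key
  have hc : ∀ u ∈ U', c (K u) ∈ K u := fun u hu => (hkey (K u) ⟨u, hu, rfl⟩).1
  have hadj : ∀ u ∈ U', G.Adj r (c (K u)) := fun u hu => (hkey (K u) ⟨u, hu, rfl⟩).2.1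
  have hmin : ∀ u ∈ U', ∀ c' ∈ K u, G.Adj r c' → p r (K u) (c (K u)) ≤ p r (K u) c' :=
    fun u hu => (hkey (K u) ⟨u, hu, rfl⟩).2.2.1
  have hI : ∀ u ∈ U', IsDFS G p (K u) (c (K u)) (par (K u)) (D (K u)) :=
    fun u hu => (hkey (K u) ⟨u, hu, rfl⟩).2.2.2
  have hcases : ∀ u ∈ U, u = r ∨ u ∈ U' := by
    intro u hu
    by_cases h : u = r
    · exact Or.inl h
    · exact Or.inr (Finset.mem_erase.2 ⟨h, hu⟩)
  have hrU' : r ∉ U' := by simp [hU']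
  have hneU' : ∀ u ∈ U', u ≠ r := fun u hu h => hrU' (h ▸ hu)
  have hUU : U' ⊆ U := Finset.erase_subset _ _
  set P : V → V := fun u => if u = c (K u) then r else par (K u) u with hP
  set E : V → Finset V := fun u => if u = r then U else D (K u) u with hE
  have Er : E r = U := by simp [hE]
  have E' : ∀ u ∈ U', E u = D (K u) u := fun u hu => by simp [hE, hneU' u hu]
  have Esub : ∀ u ∈ U', E u ⊆ K u := fun u hu => by
    rw [E' u hu]; exact (hI u hu).sub u (selfK u hu)
  have Erw : ∀ u ∈ U', ∀ x ∈ K u, E x = D (K u) x := fun u hu x hx => by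
    rw [E' x (hsub u hx), eqK u x hx]
  have Pc : ∀ u ∈ U', u = c (K u) → P u = r := fun u hu h => by simp only [hP]; rw [if_pos h]
  have Pn : ∀ u ∈ U', u ≠ c (K u) → P u = par (K u) u := fun u hu h => by simp [hP, h]
  have Pmem : ∀ u ∈ U', u ≠ c (K u) → P u ∈ K u := fun u hu h => by
    rw [Pn u hu h]; exact (hI u hu).par_mem u (selfK u hu) h
  refine ⟨P, E, ⟨hr, Er, ?_, ?_, ?_, ?_, ?_, ?_, ?_, ?_, ?_, ?_⟩⟩
  · intro u hu
    rcases hcases u hu with rfl | h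
    · rw [Er]
    · exact ((Esub u h).trans (hsub u)).trans hUU
  · intro u hu
    rcases hcases u hu with rfl | h
    · rw [Er]; exact hu
    · rw [E' u h]; exact (hI u h).self u (selfK u h)
  · intro u hu v hv huv
    rcases hcases v hv with rfl | h
    · rw [Er]
      rcases hcases u hu with rfl | h
      · rw [Er]
      · exact ((Esub u h).trans (hsub u)).trans hUU
    · have huK := Esub v h huv
      rw [E' v h] at huv ⊢
      rw [Erw v h u huK]
      exact (hI v h).trans u huK v (selfK v h) huv
  · intro u hu v hv huv hvu
    rcases hcases v hv with rfl | h
    · rcases hcases u hu with rfl | h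
      · rfl
      · exact absurd (hsub u (Esub u h hvu)) hrU'
    · have huK := Esub v h huv
      rw [E' v h] at huv
      rw [Erw v h u huK] at hvu
      exact (hI v h).anti u huK v (selfK v h) huv hvu
  · intro u hu hur
    have h := (hcases u hu).resolve_left hur
    by_cases hcu : u = c (K u)
    · rw [Pc u h hcu]; exact hr
    · exact hUU (hsub u (Pmem u h hcu))
  · intro u hu hur
    have h := (hcases u hu).resolve_left hur
    by_cases hcu : u = c (K u)
    · rw [Pc u h hcu]; have := hadj u h; rwa [← hcu] at this
    · rw [Pn u h hcu]; exact (hI u h).par_adj u (selfK u h) hcu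
  · intro u hu hur
    have h := (hcases u hu).resolve_left hur
    by_cases hcu : u = c (K u)
    · rw [Pc u h hcu, Er]; exact hu
    · rw [Erw u h _ (Pmem u h hcu), Pn u h hcu]
      exact (hI u h).par_desc u (selfK u h) hcu
  · intro u hu v hv huv hne
    rcases hcases v hv with rfl | h
    · have h := (hcases u hu).resolve_left hne
      rw [Er]
      by_cases hcu : u = c (K u)
      · rw [Pc u h hcu]; exact hv
      · exact hUU (hsub u (Pmem u h hcu))
    · have huK := Esub v h huv
      have hu' := hsub v huK
      rw [E' v h] at huv ⊢
      have e := eqK v u huK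
      have hcu : u ≠ c (K u) := by
        intro hcu
        apply hne
        refine (hI v h).anti u huK v (selfK v h) huv ?_
        rw [hcu, e, (hI v h).root]
        exact selfK v h
      rw [Pn u hu' hcu, e]
      exact (hI v h).up u huK v (selfK v h) huv hne
  · intro u hu v hv huv
    rcases hcases v hv with rfl | h
    · left; rw [Er]; exact hu
    · rcases hcases u hu with rfl | h'
      · right; rw [Er]; exact hv
      · have huK := adjK v u h h' huv.symm
        rw [E' v h, Erw v h u huK]
        exact (hI v h).edge u huK v (selfK v h) huv
  · intro u hu hur x hx hadjx
    have h := (hcases u hu).resolve_left hur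
    rw [E' u h] at hx ⊢
    by_cases hcu : u = c (K u)
    · rw [Pc u h hcu] at hadjx ⊢
      have e : D (K u) u = K u := by
        have := (hI u h).root
        rwa [← hcu] at this
      rw [e] at hx ⊢
      have := hmin u h x hx hadjx
      rwa [← hcu] at this
    · rw [Pn u h hcu] at hadjx ⊢
      exact (hI u h).rule u (selfK u h) hcu x hx hadjx

namespace IsDFS

variable {V : Type*} [Fintype V] {G : SimpleGraph V} {p : V → Finset V → V → ℕ} {r : V}
  {par : V → V} {D : V → Finset V}

theorem ne_root (h : IsDFS G p Finset.univ r par D) {u v : V} (huv : u ∈ D v) (hne : u ≠ v) :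
    u ≠ r := by
  rintro rfl
  refine hne (h.anti u (by simp) v (by simp) huv ?_)
  rw [h.root]; simp

theorem not_par_mem (h : IsDFS G p Finset.univ r par D) {u : V} (hu : u ≠ r) : par u ∉ D u := by
  intro hmem
  have := h.anti u (by simp) (par u) (by simp) (h.par_desc u (by simp) hu) hmem
  have hadj := h.par_adj u (by simp) hu
  rw [← this] at hadj
  exact hadj.ne rfl

theorem card_lt (h : IsDFS G p Finset.univ r par D) {u v : V} (huv : u ∈ D v) (hne : u ≠ v) :
    (D u).card < (D v).card := by
  apply Finset.card_lt_card
  rw [Finset.ssubset_iff_of_subset (h.trans u (by simp) v (by simp) huv)]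
  exact ⟨v, h.self v (by simp), fun hv => hne (h.anti u (by simp) v (by simp) huv hv)⟩

theorem desc_induction (h : IsDFS G p Finset.univ r par D) {v : V} {P : V → Prop} (h0 : P v)
    (h1 : ∀ u ∈ D v, u ≠ v → P (par u) → P u) : ∀ u ∈ D v, P u := by
  have key : ∀ n : ℕ, ∀ u ∈ D v, Fintype.card V - (D u).card = n → P u := by
    intro n
    induction n using Nat.strong_induction_on with
    | _ n ih =>
    intro u hu hn
    by_cases huv : u = v
    · rw [huv]; exact h0
    · have hur := h.ne_root hu huv
      have hpu : par u ≠ u := (h.par_adj u (by simp) hur).ne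
      have hlt := h.card_lt (h.par_desc u (by simp) hur) (Ne.symm hpu)
      have hle : (D (par u)).card ≤ Fintype.card V := Finset.card_le_univ _
      exact h1 u hu huv (ih _ (by omega) (par u) (h.up u (by simp) v (by simp) hu huv) rfl)
  exact fun u hu => key _ u hu rfl

theorem comparable (h : IsDFS G p Finset.univ r par D) {a b : V} :
    ∀ u, u ∈ D a → u ∈ D b → a ∈ D b ∨ b ∈ D a := by
  have := h.desc_induction (v := r) (P := fun u => u ∈ D a → u ∈ D b → a ∈ D b ∨ b ∈ D a) ?_ ?_
  · intro u
    exact this u (by rw [h.root]; simp)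
  · intro ha _
    right
    have : r = a := by
      by_contra hne
      exact h.ne_root ha hne rfl
    rw [← this, h.root]; simp
  · intro u _ _ ih ha hb
    by_cases h1 : u = a
    · left; rwa [← h1]
    by_cases h2 : u = b
    · right; rwa [← h2]
    exact ih (h.up u (by simp) a (by simp) ha h1) (h.up u (by simp) b (by simp) hb h2)

theorem exists_child (h : IsDFS G p Finset.univ r par D) {a : V} :
    ∀ u ∈ D a, u ≠ a → ∃ c, c ≠ r ∧ par c = a ∧ u ∈ D c := by
  apply h.desc_induction (v := a) (P := fun u => u ≠ a → ∃ c, c ≠ r ∧ par c = a ∧ u ∈ D c)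
  · intro h; exact absurd rfl h
  · intro u hu hne ih _
    by_cases hp : par u = a
    · exact ⟨u, h.ne_root hu hne, hp, h.self u (by simp)⟩
    · obtain ⟨c, h1, h2, h3⟩ := ih hp
      exact ⟨c, h1, h2, h.trans (par u) (by simp) c (by simp) h3
        (h.par_desc u (by simp) (h.ne_root hu hne))⟩

theorem swap_tree (h : IsDFS G p Finset.univ r par D) (B : Set V) (δ : V → V)
    (hB : ∀ u ∈ B, u ≠ r → δ u ∈ D u ∧ G.Adj (par u) (δ u)) :
    ∃ T : SimpleGraph V, T ≤ G ∧ T.IsTree ∧ (∀ u, u ≠ r → u ∉ B → T.Adj (par u) u) ∧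
      (∀ u, u ≠ r → u ∈ B → T.Adj (par u) (δ u)) := by
  set q : V → V := fun u => if u ∈ B then δ u else u with hq
  set S : Set (Sym2 V) := (fun u => s(par u, q u)) '' {u | u ≠ r} with hS
  have hqadj : ∀ u, u ≠ r → G.Adj (par u) (q u) := by
    intro u hu
    by_cases hb : u ∈ B
    · simp only [hq, if_pos hb]; exact (hB u hb hu).2
    · simp only [hq, if_neg hb]; exact h.par_adj u (by simp) hu
  have hqD : ∀ u, u ≠ r → q u ∈ D u := by
    intro u hu
    by_cases hb : u ∈ B
    · simp only [hq, if_pos hb]; exact (hB u hb hu).1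
    · simp only [hq, if_neg hb]; exact h.self u (by simp)
  set T := SimpleGraph.fromEdgeSet S with hT
  have hTadj : ∀ u, u ≠ r → T.Adj (par u) (q u) := by
    intro u hu
    rw [hT, SimpleGraph.fromEdgeSet_adj]
    exact ⟨⟨u, hu, rfl⟩, (hqadj u hu).ne⟩
  have hreach : ∀ n : ℕ, ∀ u, u ≠ r → (D u).card = n → T.Reachable u (par u) := by
    intro n
    induction n using Nat.strong_induction_on with
    | _ n ih =>
    intro u hu hn
    have hall : ∀ x ∈ D u, T.Reachable x u := by
      apply h.desc_induction (v := u) (P := fun x => T.Reachable x u)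
      · exact SimpleGraph.Reachable.refl _
      · intro x hx hne ihx
        exact (ih _ (hn ▸ h.card_lt hx hne) x (h.ne_root hx hne) rfl).trans ihx
    exact (hall _ (hqD u hu)).symm.trans (hTadj u hu).reachable.symm
  have hroot : ∀ x, T.Reachable x r := by
    have := h.desc_induction (v := r) (P := fun x => T.Reachable x r)
      (SimpleGraph.Reachable.refl _)
      (fun x _ hne ihx => (hreach _ x hne rfl).trans ihx)
    intro x
    exact this x (by rw [h.root]; simp)
  have hconn : T.Connected := by
    have : Nonempty V := ⟨r⟩
    exact ⟨fun a b => (hroot a).trans (hroot b).symm⟩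
  refine ⟨T, ?_, ?_, ?_, ?_⟩
  · intro a b hab
    rw [hT, SimpleGraph.fromEdgeSet_adj] at hab
    obtain ⟨⟨u, hu, he⟩, _⟩ := hab
    have := hqadj u hu
    rw [← SimpleGraph.mem_edgeSet] at this ⊢
    exact he ▸ this
  · rw [SimpleGraph.isTree_iff_connected_and_card]
    refine ⟨hconn, le_antisymm ?_ hconn.card_vert_le_card_edgeSet_add_one⟩
    have h1 : Nat.card T.edgeSet ≤ S.ncard := by
      rw [Nat.card_coe_set_eq]
      apply Set.ncard_le_ncard
      · rw [hT, SimpleGraph.edgeSet_fromEdgeSet]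
        exact Set.sdiff_subset
      · exact Set.toFinite _
    have h2 : S.ncard ≤ ({u | u ≠ r} : Set V).ncard := Set.ncard_image_le (Set.toFinite _)
    have h3 : ({u | u ≠ r} : Set V).ncard + 1 = Nat.card V := by
      have : ({u | u ≠ r} : Set V) = {r}ᶜ := by ext; simp
      rw [this, ← Set.ncard_add_ncard_compl ({r} : Set V), Set.ncard_singleton, add_comm]
    omega
  · intro u hu hb
    have := hTadj u hu
    simpa only [hq, if_neg hb] using this
  · intro u hu hb
    have := hTadj u hu
    simpa only [hq, if_pos hb] using this

end IsDFS

/-- `w` is joined to the parent of `u` by a usable back edge, and lies strictly below `u`. -/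
def Back {V : Type*} (G : SimpleGraph V) (r y : V) (par : V → V) (D : V → Finset V)
    (u x : V) : Prop :=
  u ≠ r ∧ x ∈ D u ∧ G.Adj (par u) x ∧ x ≠ u ∧ (par u = r → x ≠ y)

section
variable {V : Type*} [Fintype V] {G : SimpleGraph V} {p : V → Finset V → V → ℕ} {r y : V}
  {par : V → V} {D : V → Finset V}

theorem Back.unique (h : IsDFS G p Finset.univ r par D) (hcubic : ∀ v : V, G.degree v = 3)
    (hry : G.Adj r y) (hroot : par y = r → ∀ c ∈ D y, G.Adj r c → c = y)
    {u x x' : V} (h1 : Back G r y par D u x) (h2 : Back G r y par D u x') : x = x' := by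
  by_contra hne
  obtain ⟨hu, hx, hax, hxu, hxy⟩ := h1
  obtain ⟨-, hx', hax', hxu', hxy'⟩ := h2
  have hau := h.par_adj u (by simp) hu
  have hfour : ∃ f, G.Adj (par u) f ∧ f ≠ u ∧ f ≠ x ∧ f ≠ x' := by
    by_cases hpr : par u = r
    · refine ⟨y, hpr ▸ hry, ?_, (hxy hpr).symm, (hxy' hpr).symm⟩
      rintro rfl
      exact hxu (hroot hpr x hx (hpr ▸ hax))
    · have hpp : par (par u) ∉ D u := fun hm =>
        h.not_par_mem hpr (h.trans u (by simp) _ (by simp) (h.par_desc u (by simp) hu) hm)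
      refine ⟨par (par u), (h.par_adj _ (by simp) hpr).symm, ?_, ?_, ?_⟩
      · intro e; exact hpp (by rw [e]; exact h.self u (by simp))
      · intro e; exact hpp (e ▸ hx)
      · intro e; exact hpp (e ▸ hx')
  obtain ⟨f, hf, f1, f2, f3⟩ := hfour
  have hsub : ({u, x, x', f} : Finset V) ⊆ G.neighborFinset (par u) := by
    intro a ha
    simp only [Finset.mem_insert, Finset.mem_singleton] at ha
    rw [SimpleGraph.mem_neighborFinset]
    rcases ha with rfl | rfl | rfl | rfl <;> assumption
  have hc := Finset.card_le_card hsub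
  rw [SimpleGraph.card_neighborFinset_eq_degree, hcubic] at hc
  rw [Finset.card_insert_of_notMem (by simp [hxu.symm, hxu'.symm, f1.symm]),
    Finset.card_insert_of_notMem (by simp [hne, f2.symm]),
    Finset.card_insert_of_notMem (by simp [f3.symm])] at hc
  simp at hc

theorem leaf_options (h : IsDFS G p Finset.univ r par D) (hcubic : ∀ v : V, G.degree v = 3)
    (hrule : ∀ u, u ≠ r → par u ≠ r → ∀ c ∈ D u, G.Adj (par u) c →
      (G.neighborFinset u ∩ D u).card ≤ (G.neighborFinset c ∩ D u).card)
    {v : V} (hvr : v ≠ r) (hvy : v ≠ y) (hleaf : D v = {v}) :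
    ∃ y1 y2, Back G r y par D y1 v ∧ Back G r y par D y2 v ∧ y1 ≠ y2 ∧ par y1 ≠ par v ∧
      par y2 ≠ par v ∧ (y2 = y ∨ ∃ s, Back G r y par D s y2) := by
  have hpv := h.par_adj v (by simp) hvr
  have hc2 : ((G.neighborFinset v).erase (par v)).card = 2 := by
    rw [Finset.card_erase_of_mem (by simpa using hpv.symm),
      SimpleGraph.card_neighborFinset_eq_degree, hcubic]
  obtain ⟨a, b, hab, hset⟩ := Finset.card_eq_two.1 hc2
  have hmem : ∀ x, G.Adj v x ↔ x = par v ∨ x = a ∨ x = b := by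
    intro x
    have : x ∈ (G.neighborFinset v).erase (par v) ↔ x ∈ ({a, b} : Finset V) := by rw [hset]
    simp only [Finset.mem_erase, SimpleGraph.mem_neighborFinset, Finset.mem_insert,
      Finset.mem_singleton] at this
    constructor
    · intro hx
      by_cases e : x = par v
      · exact Or.inl e
      · exact Or.inr (this.1 ⟨e, hx⟩)
    · rintro (rfl | hx)
      · exact hpv.symm
      · exact (this.2 hx).2
  have hnp : ∀ x ∈ ({a, b} : Finset V), x ≠ par v := by
    intro x hx; rw [← hset] at hx; exact (Finset.mem_erase.1 hx).1
  have hap : a ≠ par v := hnp a (by simp)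
  have hbp : b ≠ par v := hnp b (by simp)
  have hdesc : ∀ x, G.Adj v x → v ∈ D x := by
    intro x hx
    rcases h.edge v (by simp) x (by simp) hx with h1 | h1
    · exact h1
    · rw [hleaf, Finset.mem_singleton] at h1
      exact absurd h1 hx.ne'
  have hva : G.Adj v a := (hmem a).2 (by simp)
  have hvb : G.Adj v b := (hmem b).2 (by simp)
  clear hset hnp hc2
  wlog hba : b ∈ D a generalizing a b with H
  · refine H b a hab.symm (fun x => ?_) hbp hap hvb hva ?_
    · rw [hmem x]; tauto
    · rcases h.comparable v (hdesc a hva) (hdesc b hvb) with h1 | h1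
      · exact h1
      · exact absurd h1 hba
  obtain ⟨y1, hy1r, hy1p, hvy1⟩ := h.exists_child v (hdesc a hva) hva.ne
  obtain ⟨y2, hy2r, hy2p, hvy2⟩ := h.exists_child v (hdesc b hvb) hvb.ne
  have hbr : b ≠ r := h.ne_root hba hab.symm
  have hb2 : b ∉ D y2 := by rw [← hy2p]; exact h.not_par_mem hy2r
  have hy2b : y2 ∈ D b := by rw [← hy2p]; exact h.par_desc y2 (by simp) hy2r
  have ha2 : a ∉ D y2 := fun ha =>
    hab (h.anti a (by simp) b (by simp) (h.trans y2 (by simp) b (by simp) hy2b ha) hba)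
  refine ⟨y1, y2, ⟨hy1r, hvy1, hy1p ▸ hva.symm, ?_, fun _ => hvy⟩,
    ⟨hy2r, hvy2, hy2p ▸ hvb.symm, ?_, fun _ => hvy⟩, ?_, hy1p ▸ hap, hy2p ▸ hbp, ?_⟩
  · rintro rfl; exact hap hy1p.symm
  · rintro rfl; exact hbp hy2p.symm
  · rintro rfl; exact hab (hy1p.symm.trans hy2p)
  by_cases hy2y : y2 = y
  · exact Or.inl hy2y
  right
  have h1 := hrule y2 hy2r (hy2p ▸ hbr) v hvy2 (hy2p ▸ hvb.symm)
  have h2 : (G.neighborFinset v ∩ D y2).card ≤ 1 := by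
    rw [← Finset.card_singleton (par v)]
    apply Finset.card_le_card
    intro x hx
    rw [Finset.mem_inter, SimpleGraph.mem_neighborFinset, hmem] at hx
    rcases hx with ⟨rfl | rfl | rfl, hx⟩
    · simp
    · exact absurd hx ha2
    · exact absurd hx hb2
  have h3 : 1 < (G.neighborFinset y2 \ D y2).card := by
    have e := Finset.card_sdiff_add_card_inter (G.neighborFinset y2) (D y2)
    rw [SimpleGraph.card_neighborFinset_eq_degree, hcubic] at e
    omega
  obtain ⟨z, hz, hzb⟩ := Finset.exists_mem_ne h3 b
  rw [Finset.mem_sdiff, SimpleGraph.mem_neighborFinset] at hz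
  have hy2z : y2 ∈ D z := (h.edge y2 (by simp) z (by simp) hz.1).resolve_right hz.2
  obtain ⟨s, hsr, hsp, hs⟩ := h.exists_child y2 hy2z hz.1.ne
  refine ⟨s, hsr, hs, hsp ▸ hz.1.symm, ?_, fun _ => hy2y⟩
  rintro rfl
  exact hzb (hsp.symm.trans hy2p)

end

theorem exists_light_edge {V : Type*} [Fintype V] [Nonempty V] (G : SimpleGraph V)
    (hcubic : ∀ v : V, G.degree v = 3) (w : V → ℝ) (hw : ∀ v : V, 0 ≤ w v) :
    ∃ r y, G.Adj r y ∧ w r + w y ≤ 3 / (Fintype.card V : ℝ) * ∑ v, w v := by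
  by_contra! hcon
  set W := ∑ v, w v with hW
  have hW0 : 0 ≤ W := Finset.sum_nonneg (fun v _ => hw v)
  have hn : (0 : ℝ) < Fintype.card V := by exact_mod_cast Fintype.card_pos
  have h1 : ∑ v, ∑ u ∈ G.neighborFinset v, (w v + w u) = 6 * W := by
    have e1 : ∑ v, ∑ u ∈ G.neighborFinset v, w v = 3 * W := by
      rw [hW, Finset.mul_sum]
      refine Finset.sum_congr rfl (fun v _ => ?_)
      rw [Finset.sum_const, SimpleGraph.card_neighborFinset_eq_degree, hcubic]
      simp
    have e2 : ∑ v, ∑ u ∈ G.neighborFinset v, w u = ∑ v, ∑ u ∈ G.neighborFinset v, w v := by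
      apply Finset.sum_comm'
      intro a b
      simp [G.adj_comm]
    simp only [Finset.sum_add_distrib]
    rw [e2, e1]; ring
  have h2 : ∑ v, ∑ u ∈ G.neighborFinset v, (3 / (Fintype.card V : ℝ) * W)
      < ∑ v, ∑ u ∈ G.neighborFinset v, (w v + w u) := by
    apply Finset.sum_lt_sum_of_nonempty Finset.univ_nonempty
    intro v _
    apply Finset.sum_lt_sum_of_nonempty
    · rw [← Finset.card_pos, SimpleGraph.card_neighborFinset_eq_degree, hcubic]; norm_num
    · intro u hu
      exact hcon v u (by simpa using hu)
  have h3 : ∑ v : V, ∑ u ∈ G.neighborFinset v, (3 / (Fintype.card V : ℝ) * W) = 9 * W := by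
    simp only [Finset.sum_const, SimpleGraph.card_neighborFinset_eq_degree, hcubic]
    simp only [Finset.card_univ, nsmul_eq_mul]
    field_simp
    push_cast
    ring
  linarith

/-- `q` is one of the vertices charged to the leaf `v`. -/
def Own {V : Type*} (G : SimpleGraph V) (r y : V) (par : V → V) (D : V → Finset V)
    (q v : V) : Prop :=
  q = v ∨ Back G r y par D q v ∨ ∃ t, Back G r y par D q t ∧ Back G r y par D t v

theorem not_back_of_leaf {V : Type*} {G : SimpleGraph V} {r y : V} {par : V → V}
    {D : V → Finset V} {v x : V} (hleaf : D v = {v}) : ¬ Back G r y par D v x := by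
  rintro ⟨-, h1, -, h2, -⟩
  rw [hleaf, Finset.mem_singleton] at h1
  exact h2 h1

theorem Own.unique {V : Type*} [Fintype V] {G : SimpleGraph V} {p : V → Finset V → V → ℕ}
    {r y : V} {par : V → V} {D : V → Finset V}
    (h : IsDFS G p Finset.univ r par D) (hcubic : ∀ v : V, G.degree v = 3)
    (hry : G.Adj r y) (hroot : par y = r → ∀ c ∈ D y, G.Adj r c → c = y)
    {q v v' : V} (hv : D v = {v}) (hv' : D v' = {v'})
    (h1 : Own G r y par D q v) (h2 : Own G r y par D q v') : v = v' := by
  rcases h1 with rfl | h1 | ⟨t, h1, h1'⟩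
  · rcases h2 with rfl | h2 | ⟨t', h2, -⟩
    · rfl
    · exact absurd h2 (not_back_of_leaf hv)
    · exact absurd h2 (not_back_of_leaf hv)
  · rcases h2 with rfl | h2 | ⟨t', h2, h2'⟩
    · exact absurd h1 (not_back_of_leaf hv')
    · exact Back.unique h hcubic hry hroot h1 h2
    · have := Back.unique h hcubic hry hroot h1 h2
      subst this
      exact absurd h2' (not_back_of_leaf hv)
  · rcases h2 with rfl | h2 | ⟨t', h2, h2'⟩
    · exact absurd h1 (not_back_of_leaf hv')
    · have := Back.unique h hcubic hry hroot h1 h2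
      subst this
      exact absurd h1' (not_back_of_leaf hv')
    · have := Back.unique h hcubic hry hroot h1 h2
      subst this
      exact Back.unique h hcubic hry hroot h1' h2'

theorem leaf_choice {V : Type*} [Fintype V] {G : SimpleGraph V} {p : V → Finset V → V → ℕ}
    {r y : V} {par : V → V} {D : V → Finset V}
    (h : IsDFS G p Finset.univ r par D) (hcubic : ∀ v : V, G.degree v = 3)
    (hry : G.Adj r y) (hroot : par y = r → ∀ c ∈ D y, G.Adj r c → c = y)
    (hrule : ∀ u, u ≠ r → par u ≠ r → ∀ c ∈ D u, G.Adj (par u) c →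
      (G.neighborFinset u ∩ D u).card ≤ (G.neighborFinset c ∩ D u).card)
    (w : V → ℝ) (hw : ∀ v, 0 ≤ w v) (hwy : w y = 0)
    {v : V} (hvr : v ≠ r) (hvy : v ≠ y) (hleaf : D v = {v}) :
    ∃ (l : V) (B : Set V),
      4 * w l ≤ ∑ q ∈ Finset.univ.filter (fun q => Own G r y par D q v), w q ∧
      (∀ u ∈ B, ∃ x, Back G r y par D u x) ∧
      (l = v ∨ ∃ u ∈ B, Back G r y par D u v ∧ par u ≠ par v) ∧
      (∀ u ∈ B, u = l ∨ ∃ s ∈ B, Back G r y par D s u) := by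
  obtain ⟨y1, y2, hb1, hb2, h12, hp1, hp2, hs⟩ :=
    leaf_options (y := y) h hcubic hrule hvr hvy hleaf
  by_cases hy2 : y2 = y
  · refine ⟨y2, {y2}, ?_, ?_, ?_, ?_⟩
    · rw [hy2, hwy, mul_zero]
      exact Finset.sum_nonneg (fun q _ => hw q)
    · rintro u rfl; exact ⟨v, hb2⟩
    · exact Or.inr ⟨y2, rfl, hb2, hp2⟩
    · rintro u rfl; exact Or.inl rfl
  obtain ⟨s, hs⟩ := hs.resolve_left hy2
  have hvy1 : v ≠ y1 := hb1.2.2.2.1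
  have hvy2 : v ≠ y2 := hb2.2.2.2.1
  have hsv : v ≠ s := by rintro rfl; exact not_back_of_leaf hleaf hs
  have hsy2 : y2 ≠ s := hs.2.2.2.1
  have hsy1 : y1 ≠ s := by
    rintro rfl
    exact hvy2 (Back.unique h hcubic hry hroot hb1 hs)
  have hsum : w v + w y1 + w y2 + w s ≤
      ∑ q ∈ Finset.univ.filter (fun q => Own G r y par D q v), w q := by
    have e : ∑ q ∈ ({v, y1, y2, s} : Finset V), w q = w v + w y1 + w y2 + w s := by
      rw [Finset.sum_insert (by simp [hvy1, hvy2, hsv]), Finset.sum_insert (by simp [h12, hsy1]),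
        Finset.sum_insert (by simp [hsy2]), Finset.sum_singleton]
      ring
    rw [← e]
    apply Finset.sum_le_sum_of_subset_of_nonneg
    · intro q hq
      simp only [Finset.mem_insert, Finset.mem_singleton] at hq
      rw [Finset.mem_filter]
      refine ⟨Finset.mem_univ _, ?_⟩
      rcases hq with rfl | rfl | rfl | rfl
      · exact Or.inl rfl
      · exact Or.inr (Or.inl hb1)
      · exact Or.inr (Or.inl hb2)
      · exact Or.inr (Or.inr ⟨y2, hs, hb2⟩)
    · exact fun q _ _ => hw q
  by_cases c0 : w v ≤ w y1 ∧ w v ≤ w y2 ∧ w v ≤ w s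
  · refine ⟨v, ∅, by linarith, by simp, Or.inl rfl, by simp⟩
  by_cases c1 : w y1 ≤ w v ∧ w y1 ≤ w y2 ∧ w y1 ≤ w s
  · refine ⟨y1, {y1}, by linarith, ?_, Or.inr ⟨y1, rfl, hb1, hp1⟩, ?_⟩
    · rintro u rfl; exact ⟨v, hb1⟩
    · rintro u rfl; exact Or.inl rfl
  by_cases c2 : w y2 ≤ w v ∧ w y2 ≤ w y1 ∧ w y2 ≤ w s
  · refine ⟨y2, {y2}, by linarith, ?_, Or.inr ⟨y2, rfl, hb2, hp2⟩, ?_⟩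
    · rintro u rfl; exact ⟨v, hb2⟩
    · rintro u rfl; exact Or.inl rfl
  have c3 : w s ≤ w v ∧ w s ≤ w y1 ∧ w s ≤ w y2 := by grind
  refine ⟨s, {y2, s}, by linarith, ?_, Or.inr ⟨y2, Or.inl rfl, hb2, hp2⟩, ?_⟩
  · rintro u (rfl | rfl)
    · exact ⟨v, hb2⟩
    · exact ⟨y2, hs⟩
  · rintro u (rfl | rfl)
    · exact Or.inr ⟨s, Or.inr rfl, hs⟩
    · exact Or.inl rfl

/-- Every connected cubic graph on `n` vertices with nonnegative vertex weights has a
spanning tree whose internal weight is at least `(3/4 - 3/n)` times the total weight. -/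
theorem cubic_spanning_tree_internal_weight
    {V : Type*} [Fintype V] (G : SimpleGraph V)
    (hconn : G.Connected) (hcubic : ∀ v : V, G.degree v = 3)
    (w : V → ℝ) (hw : ∀ v : V, 0 ≤ w v) :
    ∃ T : SimpleGraph V, T ≤ G ∧ T.IsTree ∧
      (3 / 4 - 3 / (Fintype.card V : ℝ)) * (∑ v : V, w v) ≤ internalWeight T w := by
  have hne : Nonempty V := hconn.nonempty
  obtain ⟨r, y, hry, hlight⟩ := exists_light_edge G hcubic w hw
  obtain ⟨par, D, h⟩ := exists_isDFS G
    (fun x C c => if x = r then (if c = y then 1 else 0) else (G.neighborFinset c ∩ C).card)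
    _ Finset.univ r rfl (Finset.mem_univ r) (by
      intro u _
      obtain ⟨q⟩ := hconn.preconnected u r
      induction q with
      | nil => exact Relation.ReflTransGen.refl
      | cons hadj _ ih =>
        exact Relation.ReflTransGen.head ⟨hadj, Finset.mem_univ _, Finset.mem_univ _⟩
          (ih hry hlight (Finset.mem_univ _)))
  have hroot : par y = r → ∀ c ∈ D y, G.Adj r c → c = y := by
    intro hp c hc hadj
    have := h.rule y (by simp) hry.ne' c hc (hp ▸ hadj)
    by_contra hcy
    simp [hp, hcy] at this
  have hrule : ∀ u, u ≠ r → par u ≠ r → ∀ c ∈ D u, G.Adj (par u) c →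
      (G.neighborFinset u ∩ D u).card ≤ (G.neighborFinset c ∩ D u).card := by
    intro u hu hp c hc hadj
    have := h.rule u (by simp) hu c hc hadj
    simpa [hp] using this
  set w' : V → ℝ := fun v => if v = r ∨ v = y then 0 else w v with hw'
  have hw'0 : ∀ v, 0 ≤ w' v := by
    intro v; simp only [hw']; split_ifs
    · exact le_rfl
    · exact hw v
  have hw'le : ∀ v, w' v ≤ w v := by
    intro v; simp only [hw']; split_ifs
    · exact hw v
    · exact le_rfl
  have hch : ∀ v : V, ∃ (l : V) (B : Set V), (v ≠ r ∧ v ≠ y ∧ D v = {v}) →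
      4 * w' l ≤ ∑ q ∈ Finset.univ.filter (fun q => Own G r y par D q v), w' q ∧
      (∀ u ∈ B, ∃ x, Back G r y par D u x) ∧
      (l = v ∨ ∃ u ∈ B, Back G r y par D u v ∧ par u ≠ par v) ∧
      (∀ u ∈ B, u = l ∨ ∃ s ∈ B, Back G r y par D s u) := by
    intro v
    by_cases hv : v ≠ r ∧ v ≠ y ∧ D v = {v}
    · obtain ⟨l, B, hlB⟩ := leaf_choice h hcubic hry hroot hrule w' hw'0 (by simp [hw'])
        hv.1 hv.2.1 hv.2.2
      exact ⟨l, B, fun _ => hlB⟩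
    · exact ⟨v, ∅, fun hv' => absurd hv' hv⟩
  choose l Bv hlB using hch
  set good : Finset V := Finset.univ.filter (fun v => v ≠ r ∧ v ≠ y ∧ D v = {v}) with hgood
  have hgm : ∀ v, v ∈ good ↔ (v ≠ r ∧ v ≠ y ∧ D v = {v}) := by intro v; simp [hgood]
  set B : Set V := {u | ∃ v ∈ good, u ∈ Bv v} with hB
  have hBback : ∀ u ∈ B, ∃ x, Back G r y par D u x := by
    rintro u ⟨v, hv, hu⟩
    exact (hlB v ((hgm v).1 hv)).2.1 u hu
  have hδ : ∀ u, ∃ x, u ∈ B → Back G r y par D u x := by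
    intro u
    by_cases hu : u ∈ B
    · obtain ⟨x, hx⟩ := hBback u hu
      exact ⟨x, fun _ => hx⟩
    · exact ⟨u, fun h => absurd h hu⟩
  choose δ hδ using hδ
  obtain ⟨T, hTG, hTree, hT1, hT2⟩ := h.swap_tree B δ
    (fun u hu _ => ⟨(hδ u hu).2.1, (hδ u hu).2.2.1⟩)
  have hTback : ∀ u ∈ B, ∀ x, Back G r y par D u x → T.Adj (par u) x := by
    intro u hu x hx
    rw [Back.unique h hcubic hry hroot hx (hδ u hu)]
    exact hT2 u hx.1 hu
  have hchild : ∀ u, D u ≠ {u} → ∃ x ∈ D u, T.Adj u x := by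
    intro u hu
    have : ∃ x ∈ D u, x ≠ u := by
      by_contra! hcon
      apply hu
      ext x
      rw [Finset.mem_singleton]
      exact ⟨hcon x, fun e => by rw [e]; exact h.self u (by simp)⟩
    obtain ⟨x, hx, hxu⟩ := this
    obtain ⟨c, hcr, hcp, -⟩ := h.exists_child x hx hxu
    have hcu : c ∈ D u := hcp ▸ h.par_desc c (by simp) hcr
    by_cases hcB : c ∈ B
    · exact ⟨δ c, h.trans c (by simp) u (by simp) hcu (hδ c hcB).2.1, hcp ▸ hT2 c hcr hcB⟩
    · exact ⟨c, hcu, hcp ▸ hT1 c hcr hcB⟩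
  have hdeg2 : ∀ u a b, T.Adj u a → T.Adj u b → a ≠ b → 2 ≤ T.degree u := by
    intro u a b ha hb hab
    rw [← SimpleGraph.card_neighborFinset_eq_degree]
    exact Finset.one_lt_card.2 ⟨a, by simpa using ha, b, by simpa using hb, hab⟩
  have hmain : ∀ u, u ≠ r → u ≠ y → (∀ v ∈ good, u ≠ l v) → 2 ≤ T.degree u := by
    intro u hur huy hul
    by_cases hleaf : D u = {u}
    · have hg : u ∈ good := (hgm u).2 ⟨hur, huy, hleaf⟩
      obtain ⟨-, -, h3, -⟩ := hlB u ((hgm u).1 hg)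
      obtain ⟨c, hc, hback, hpne⟩ := h3.resolve_left (hul u hg).symm
      have huB : u ∉ B := fun hu => by
        obtain ⟨x, hx⟩ := hBback u hu
        exact not_back_of_leaf hleaf hx
      exact hdeg2 u (par u) (par c) (hT1 u hur huB).symm
        (hTback c ⟨u, hg, hc⟩ u hback).symm hpne.symm
    · obtain ⟨x, hx, hux⟩ := hchild u hleaf
      by_cases huB : u ∈ B
      · obtain ⟨v, hv, huv⟩ := huB
        obtain ⟨s, hs, hback⟩ :=
          ((hlB v ((hgm v).1 hv)).2.2.2 u huv).resolve_left (hul v hv)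
        refine hdeg2 u x (par s) hux (hTback s ⟨v, hv, hs⟩ u hback).symm ?_
        rintro rfl
        exact h.not_par_mem hback.1 (h.trans u (by simp) s (by simp) hback.2.1 hx)
      · refine hdeg2 u x (par u) hux (hT1 u hur huB).symm ?_
        rintro rfl
        exact h.not_par_mem hur hx
  refine ⟨T, hTG, hTree, ?_⟩
  have hsplit : internalWeight T w +
      ∑ v ∈ Finset.univ.filter (fun v => ¬ 2 ≤ T.degree v), w v = ∑ v, w v :=
    Finset.sum_filter_add_sum_filter_not _ _ _
  set N : Finset V := Finset.univ.filter (fun v => ¬ 2 ≤ T.degree v) with hN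
  have hN1 : ∑ v ∈ N, w v ≤ ∑ v ∈ N, w' v + (w r + w y) := by
    have e : ∀ v, w v ≤ w' v + ((if v = r then w r else 0) + (if v = y then w y else 0)) := by
      intro v
      have := hw r
      have := hw y
      simp only [hw']
      by_cases h1 : v = r
      · subst h1; simp; split_ifs <;> linarith
      · by_cases h2 : v = y
        · subst h2; simp [h1]
        · simp [h1, h2]
    calc ∑ v ∈ N, w v
        ≤ ∑ v ∈ N, (w' v + ((if v = r then w r else 0) + (if v = y then w y else 0))) :=
          Finset.sum_le_sum (fun v _ => e v)
      _ = ∑ v ∈ N, w' v + (∑ v ∈ N, (if v = r then w r else 0)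
            + ∑ v ∈ N, (if v = y then w y else 0)) := by
          rw [Finset.sum_add_distrib, Finset.sum_add_distrib]
      _ ≤ _ := by
          rw [Finset.sum_ite_eq', Finset.sum_ite_eq']
          have := hw r
          have := hw y
          split_ifs <;> linarith
  have hN2 : ∑ v ∈ N, w' v ≤ ∑ v ∈ good, w' (l v) := by
    calc ∑ u ∈ N, w' u ≤ ∑ u ∈ N, ∑ v ∈ good with l v = u, w' (l v) := by
          apply Finset.sum_le_sum
          intro u hu
          have hnn : ∀ v ∈ good.filter (fun v => l v = u), 0 ≤ w' (l v) := fun v _ => hw'0 _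
          by_cases hur : u = r ∨ u = y
          · have : w' u = 0 := by simp only [hw', if_pos hur]
            rw [this]; exact Finset.sum_nonneg hnn
          · push Not at hur
            have : ∃ v ∈ good, u = l v := by
              by_contra! hcon
              exact (Finset.mem_filter.1 hu).2 (hmain u hur.1 hur.2 hcon)
            obtain ⟨v, hv, hul⟩ := this
            calc w' u = w' (l v) := by rw [hul]
              _ ≤ _ := Finset.single_le_sum (f := fun v => w' (l v)) hnn
                (Finset.mem_filter.2 ⟨hv, hul.symm⟩)
      _ ≤ ∑ u, ∑ v ∈ good with l v = u, w' (l v) :=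
          Finset.sum_le_sum_of_subset_of_nonneg (Finset.subset_univ _)
            (fun u _ _ => Finset.sum_nonneg (fun v _ => hw'0 _))
      _ = ∑ v ∈ good, w' (l v) := Finset.sum_fiberwise _ _ _
  have hN3 : 4 * ∑ v ∈ good, w' (l v) ≤ ∑ v, w' v := by
    rw [Finset.mul_sum]
    calc ∑ v ∈ good, 4 * w' (l v)
        ≤ ∑ v ∈ good, ∑ q ∈ Finset.univ.filter (fun q => Own G r y par D q v), w' q :=
          Finset.sum_le_sum (fun v hv => (hlB v ((hgm v).1 hv)).1)
      _ = ∑ q ∈ good.biUnion (fun v => Finset.univ.filter (fun q => Own G r y par D q v)), w' q := by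
          rw [Finset.sum_biUnion]
          intro v hv v' hv' hne
          rw [Function.onFun, Finset.disjoint_left]
          intro q hq hq'
          exact hne (Own.unique h hcubic hry hroot ((hgm v).1 hv).2.2 ((hgm v').1 hv').2.2
            (Finset.mem_filter.1 hq).2 (Finset.mem_filter.1 hq').2)
      _ ≤ _ := Finset.sum_le_sum_of_subset_of_nonneg (Finset.subset_univ _)
          (fun u _ _ => hw'0 u)
  have hN4 : ∑ v, w' v ≤ ∑ v, w v := Finset.sum_le_sum (fun v _ => hw'le v)
  have : (3 / 4 - 3 / (Fintype.card V : ℝ)) * (∑ v : V, w v)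
      = 3 / 4 * (∑ v, w v) - 3 / (Fintype.card V : ℝ) * ∑ v, w v := by ring
  rw [this]
  linarith
end

section
/- Let G be a connected claw-free graph on n vertices in which every vertex has degree at least 3, with a nonnegative weight w(v) assigned to each vertex v. Then G has a spanning tree T such that the sum of the weights of the internal vertices of T is at least (3/5 − 1/n) times the total weight of all vertices of G. -/
open scoped Classical

/-- A graph is claw-free if it has no induced `K_{1,3}`: among any three distinct neighbors
of a vertex, some two are adjacent. -/
def ClawFree {V : Type*} (G : SimpleGraph V) : Prop :=
  ∀ v a b c : V, G.Adj v a → G.Adj v b → G.Adj v c → a ≠ b → a ≠ c → b ≠ c →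
    G.Adj a b ∨ G.Adj a c ∨ G.Adj b c

namespace ClawTree

open SimpleGraph

section Toolkit

variable {V : Type*} {T : SimpleGraph V}

lemma exists_closer (hT : T.IsTree) {r x : V} (h : x ≠ r) :
    ∃ y, T.Adj x y ∧ T.dist r y + 1 = T.dist r x := by
  obtain ⟨p, hp⟩ := hT.connected.exists_walk_length_eq_dist x r
  cases p with
  | nil => exact absurd rfl h
  | cons hxy q =>
    rename_i y
    refine ⟨y, hxy, ?_⟩
    have h1 : T.dist y r ≤ q.length := dist_le q
    simp only [Walk.length_cons] at hp
    rw [dist_comm (u := r), dist_comm (u := r)]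
    rw [← hp]
    have h2 := hT.dist_eq_dist_add_one_of_adj r hxy
    rw [dist_comm (u := r), dist_comm (u := r)] at h2
    omega

lemma near_reach (hT : T.IsTree) {a u v : V} (h : T.dist a u < T.dist a v) :
    (T.deleteEdges {s(u, v)}).Reachable a u := by
  rw [reachable_deleteEdges_iff_exists_walk]
  obtain ⟨p, hp⟩ := hT.connected.exists_walk_length_eq_dist a u
  refine ⟨p, fun hmem => ?_⟩
  have hv : v ∈ p.support := p.snd_mem_support_of_mem_edges hmem
  have h1 := dist_le (p.takeUntil v hv)
  have h2 := p.length_takeUntil_le_length hv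
  omega

/-- Exchange of the edge `uv` for the edge `ab`. -/
def xch (T : SimpleGraph V) (u v a b : V) : SimpleGraph V :=
  T.deleteEdges {s(u, v)} ⊔ edge a b

lemma xch_adj {u v a b c d : V} :
    (xch T u v a b).Adj c d ↔
      (T.Adj c d ∧ s(c, d) ≠ s(u, v)) ∨ (s(c, d) = s(a, b) ∧ a ≠ b) := by
  unfold xch
  rw [sup_adj, deleteEdges_adj, edge_adj]
  simp only [Set.mem_singleton_iff, Sym2.eq_iff, ne_eq]
  constructor
  · rintro (h | ⟨h, h'⟩)
    · exact Or.inl h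
    · right; refine ⟨by tauto, ?_⟩
      rintro rfl; apply h'; rcases h with h | h <;> exact h.1.trans h.2.symm
  · rintro (h | ⟨h, h'⟩)
    · exact Or.inl h
    · right; refine ⟨by tauto, ?_⟩
      rintro rfl; apply h'; rcases h with h | h
      · exact h.1.symm.trans h.2
      · exact h.2.symm.trans h.1

lemma xch_le {G : SimpleGraph V} (hT : T ≤ G) {u v a b : V} (h : G.Adj a b) :
    xch T u v a b ≤ G := by
  intro c d hcd
  rw [xch_adj] at hcd
  rcases hcd with hcd | ⟨hcd, -⟩
  · exact hT hcd.1
  · rw [← mem_edgeSet, hcd]; exact h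

lemma xch_tree (hT : T.IsTree) {u v a b : V} (huv : T.Adj u v)
    (ha : T.dist a u < T.dist a v) (hb : T.dist b v < T.dist b u) :
    (xch T u v a b).IsTree := by
  have ra := near_reach hT ha
  have rb := near_reach hT hb
  rw [Sym2.eq_swap] at rb
  have hbr : ¬ (T.deleteEdges {s(u, v)}).Reachable u v :=
    (isAcyclic_iff_forall_adj_isBridge.mp hT.isAcyclic) huv
  have hab : ¬ (T.deleteEdges {s(u, v)}).Reachable a b := fun h =>
    hbr ((ra.symm.trans h).trans rb)
  have hne : a ≠ b := by rintro rfl; exact hab (Reachable.refl _)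
  have hle : T.deleteEdges {s(u, v)} ≤ xch T u v a b := le_sup_left
  have hadj : (xch T u v a b).Adj a b := by rw [xch_adj]; exact Or.inr ⟨rfl, hne⟩
  have huv' : (xch T u v a b).Reachable u v :=
    ((ra.symm.mono hle).trans hadj.reachable).trans (rb.mono hle)
  have hne' := hT.connected.nonempty
  refine ⟨⟨fun c d => ?_⟩, ?_⟩
  · obtain ⟨p⟩ := hT.connected c d
    induction p with
    | nil => exact Reachable.refl _
    | cons h q ih =>
      rename_i c e f
      refine Reachable.trans ?_ ih
      by_cases he : s(c, e) = s(u, v)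
      · rw [Sym2.eq_iff] at he
        rcases he with ⟨rfl, rfl⟩ | ⟨rfl, rfl⟩
        · exact huv'
        · exact huv'.symm
      · exact Adj.reachable (xch_adj.mpr (Or.inl ⟨h, he⟩))
  · exact IsAcyclic.sup_edge_of_not_reachable hab (hT.isAcyclic.anti (deleteEdges_le _))

lemma closer_unique (hT : T.IsTree) {r x y z : V} (hy : T.Adj x y) (hz : T.Adj x z)
    (dy : T.dist r y < T.dist r x) (dz : T.dist r z < T.dist r x) : y = z := by
  by_contra hne
  have hbr : ¬ (T.deleteEdges {s(x, y)}).Reachable x y :=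
    (isAcyclic_iff_forall_adj_isBridge.mp hT.isAcyclic) hy
  have r1 := near_reach hT dy
  rw [Sym2.eq_swap] at r1
  have r2 : (T.deleteEdges {s(x, y)}).Reachable r z := by
    rw [reachable_deleteEdges_iff_exists_walk]
    obtain ⟨p, hp⟩ := hT.connected.exists_walk_length_eq_dist r z
    refine ⟨p, fun hmem => ?_⟩
    have hv : x ∈ p.support := p.fst_mem_support_of_mem_edges hmem
    have h1 := dist_le (p.takeUntil x hv)
    have h2 := p.length_takeUntil_le_length hv
    omega
  have r3 : (T.deleteEdges {s(x, y)}).Adj x z := by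
    rw [deleteEdges_adj]
    refine ⟨hz, ?_⟩
    simp only [Set.mem_singleton_iff, Sym2.eq_iff]
    rintro (h | h)
    · exact hne h.2.symm
    · exact hy.ne h.1
  exact hbr ((r3.reachable.trans r2.symm).trans r1)

lemma dist_adj (hT : T.IsTree) (r : V) {x y : V} (h : T.Adj x y) :
    T.dist r x = T.dist r y + 1 ∨ T.dist r y = T.dist r x + 1 :=
  hT.dist_eq_dist_add_one_of_adj r h

lemma dist_two (hT : T.IsTree) {a b c : V} (h1 : T.Adj a b) (h2 : T.Adj b c) (h : a ≠ c) :
    T.dist a c = 2 := by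
  have h3 := dist_eq_one_iff_adj.mpr h1
  have h4 := dist_adj hT a h2
  have h5 := hT.connected.pos_dist_of_ne h
  omega

lemma no_tri (hT : T.IsTree) {a b c : V} (h1 : T.Adj a b) (h2 : T.Adj b c) : ¬ T.Adj a c := by
  intro h
  have h3 := dist_two hT h1 h2 h.ne
  have h4 := dist_eq_one_iff_adj.mpr h
  omega

/-- The neighbour of `x` towards `r`. -/
noncomputable def par (T : SimpleGraph V) (r x : V) : V :=
  if h : ∃ y, T.Adj x y ∧ T.dist r y + 1 = T.dist r x then h.choose else x

lemma par_spec (hT : T.IsTree) {r x : V} (h : x ≠ r) :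
    T.Adj x (par T r x) ∧ T.dist r (par T r x) + 1 = T.dist r x := by
  have h' := exists_closer hT h
  unfold par
  rw [dif_pos h']
  exact h'.choose_spec

lemma par_eq (hT : T.IsTree) {r x y : V} (h : T.Adj x y) (hd : T.dist r y < T.dist r x) :
    par T r x = y := by
  have hx : x ≠ r := by rintro rfl; simp at hd
  obtain ⟨h1, h2⟩ := par_spec hT hx
  exact closer_unique hT h1 h (by omega) hd

variable [Fintype V]

lemma degree_sum (T : SimpleGraph V) (c : V) :
    T.degree c = ∑ d : V, if T.Adj c d then 1 else 0 := by
  rw [← card_neighborFinset_eq_degree, Finset.card_eq_sum_ones, ← Finset.sum_filter]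
  congr 1
  ext d; simp

lemma sum_edge_ind {u v c : V} (h : u ≠ v) :
    (∑ d : V, if s(c, d) = s(u, v) then 1 else 0) =
      (if c = u then 1 else 0) + (if c = v then 1 else 0) := by
  have : ∀ d : V, (if s(c, d) = s(u, v) then 1 else 0) =
      (if d = v then (if c = u then 1 else 0) else 0) +
        (if d = u then (if c = v then 1 else 0) else 0) := by
    intro d
    simp only [Sym2.eq_iff]
    split_ifs <;> simp_all
  rw [Finset.sum_congr rfl (fun d _ => this d), Finset.sum_add_distrib]
  simp

lemma xch_degree {u v a b : V} (huv : T.Adj u v) (hab : ¬ T.Adj a b) (hne : a ≠ b) (c : V) :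
    (xch T u v a b).degree c + ((if c = u then 1 else 0) + (if c = v then 1 else 0)) =
      T.degree c + ((if c = a then 1 else 0) + (if c = b then 1 else 0)) := by
  rw [degree_sum, degree_sum, ← sum_edge_ind huv.ne, ← sum_edge_ind hne,
    ← Finset.sum_add_distrib, ← Finset.sum_add_distrib]
  refine Finset.sum_congr rfl fun d _ => ?_
  have h1 : s(c, d) = s(u, v) → T.Adj c d := fun h => by rw [← mem_edgeSet, h]; exact huv
  have h2 : s(c, d) = s(a, b) → ¬ T.Adj c d := fun h h' => hab (by
    rw [← mem_edgeSet, ← h]; exact h')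
  simp only [xch_adj]
  split_ifs <;> first | rfl | (exfalso; tauto)

lemma exists_other {x : V} (y : V) (h : 2 ≤ T.degree x) : ∃ z, T.Adj x z ∧ z ≠ y := by
  by_contra hc
  push Not at hc
  have : T.neighborFinset x ⊆ {y} := by
    intro z hz
    simp only [mem_neighborFinset] at hz
    simp [hc z hz]
  have := Finset.card_le_card this
  rw [card_neighborFinset_eq_degree] at this
  simp at this
  omega

lemma exists_other2 {x : V} (y y' : V) (h : 3 ≤ T.degree x) :
    ∃ z, T.Adj x z ∧ z ≠ y ∧ z ≠ y' := by
  by_contra hc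
  push Not at hc
  have : T.neighborFinset x ⊆ {y, y'} := by
    intro z hz
    simp only [mem_neighborFinset] at hz
    have := hc z hz
    simp only [Finset.mem_insert, Finset.mem_singleton]
    tauto
  have := Finset.card_le_card this
  rw [card_neighborFinset_eq_degree] at this
  have := Finset.card_le_two (a := y) (b := y')
  omega

lemma two_le_degree {x a b : V} (ha : T.Adj x a) (hb : T.Adj x b) (h : a ≠ b) :
    2 ≤ T.degree x := by
  have : ({a, b} : Finset V) ⊆ T.neighborFinset x := by
    intro z hz
    simp only [Finset.mem_insert, Finset.mem_singleton] at hz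
    rcases hz with rfl | rfl <;> simpa
  have := Finset.card_le_card this
  rw [card_neighborFinset_eq_degree, Finset.card_pair h] at this
  exact this

lemma three_le_degree {x a b c : V} (ha : T.Adj x a) (hb : T.Adj x b) (hc : T.Adj x c)
    (h : a ≠ b) (h' : a ≠ c) (h'' : b ≠ c) : 3 ≤ T.degree x := by
  have : ({a, b, c} : Finset V) ⊆ T.neighborFinset x := by
    intro z hz
    simp only [Finset.mem_insert, Finset.mem_singleton] at hz
    rcases hz with rfl | rfl | rfl <;> simpa
  have := Finset.card_le_card this
  rw [card_neighborFinset_eq_degree, Finset.card_eq_three.mpr ⟨a, b, c, h, h', h'', rfl⟩] at this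
  exact this

lemma leaf_nbr {l p c : V} (hl : T.degree l < 2) (hp : T.Adj l p) (hc : T.Adj l c) : c = p := by
  by_contra h
  have := two_le_degree hc hp h
  omega

lemma leaf_dist (hT : T.IsTree) {l p x : V} (hl : T.degree l < 2) (hp : T.Adj l p) (hx : x ≠ l) :
    T.dist x p + 1 = T.dist x l := by
  obtain ⟨y, hy, hd⟩ := exists_closer hT hx.symm
  rw [leaf_nbr hl hp hy] at hd
  exact hd

/-- a vertex nearer to a degree-2 vertex adjacent to a leaf -/
lemma side_p (hT : T.IsTree) {l p q x : V} (hl : T.degree l < 2) (hp : T.Adj l p)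
    (hp2 : T.degree p = 2) (hq : T.Adj p q) (hql : q ≠ l)
    (hx : T.dist x p < T.dist x q) : x = l ∨ x = p := by
  by_contra hc
  push Not at hc
  obtain ⟨y, hy, hd⟩ := exists_closer hT hc.2.symm
  have h1 := leaf_dist hT hl hp hc.1
  have : y ≠ l := by rintro rfl; omega
  have : y ≠ q := by rintro rfl; omega
  have := three_le_degree hp.symm hq hy hql.symm (by tauto) (by tauto)
  omega

/-- Sides of an edge are stable under changes away from `x`. -/
lemma avoid {T₁ : SimpleGraph V} (hT : T.IsTree) (hT₁ : T₁.IsTree) {l x y : V}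
    (hd : T.dist l y < T.dist l x) (hxy : T₁.Adj x y)
    (hE : ∀ c d, T.Adj c d → c ≠ x → d ≠ x → T₁.Adj c d) : T₁.dist l y < T₁.dist l x := by
  by_contra hc
  have hd1 : T₁.dist l x < T₁.dist l y := by
    have := dist_adj hT₁ l hxy
    omega
  have r1 := near_reach hT₁ hd1
  have hbr : ¬ (T₁.deleteEdges {s(x, y)}).Reachable x y :=
    (isAcyclic_iff_forall_adj_isBridge.mp hT₁.isAcyclic) hxy
  obtain ⟨p, hp⟩ := hT.connected.exists_walk_length_eq_dist l y
  have hx : x ∉ p.support := by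
    intro hv
    have h1 := dist_le (p.takeUntil x hv)
    have h2 := p.length_takeUntil_le_length hv
    omega
  have key : ∀ (a b : V) (q : T.Walk a b), x ∉ q.support →
      (T₁.deleteEdges {s(x, y)}).Reachable a b := by
    intro a b q
    induction q with
    | nil => intro _; exact Reachable.refl _
    | cons h q ih =>
      rename_i c e f
      intro hs
      rw [Walk.support_cons, List.mem_cons, not_or] at hs
      refine Reachable.trans (Adj.reachable ?_) (ih hs.2)
      have he : e ≠ x := by
        rintro rfl
        exact hs.2 q.start_mem_support
      rw [deleteEdges_adj]
      refine ⟨hE _ _ h (Ne.symm hs.1) he, ?_⟩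
      simp only [Set.mem_singleton_iff, Sym2.eq_iff]
      rintro (h' | h')
      · exact hs.1 h'.1.symm
      · exact he h'.2
  exact hbr (r1.symm.trans (key _ _ p hx))

/-- Adjacent vertices on different sides of an edge are the ends of that edge. -/
lemma side_adj (hT : T.IsTree) {x y u v : V} (hxy : T.Adj x y) (huv : T.Adj u v)
    (hy : T.dist y u < T.dist y v) (hx : T.dist x v < T.dist x u) : y = u ∧ x = v := by
  by_contra hc
  have hbr : ¬ (T.deleteEdges {s(u, v)}).Reachable u v :=
    (isAcyclic_iff_forall_adj_isBridge.mp hT.isAcyclic) huv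
  have r1 := near_reach hT hy
  have r2 := near_reach hT hx
  rw [Sym2.eq_swap] at r2
  have r3 : (T.deleteEdges {s(u, v)}).Adj x y := by
    rw [deleteEdges_adj]
    refine ⟨hxy, ?_⟩
    simp only [Set.mem_singleton_iff, Sym2.eq_iff]
    rintro (h' | h')
    · rw [h'.1, dist_self] at hx
      omega
    · exact hc ⟨h'.2, h'.1⟩
  exact hbr ((r1.symm.trans r3.symm.reachable).trans r2)

/-- `l` is the only leaf on its side of the edge from `x` towards `l`. -/
def Arm (T : SimpleGraph V) (l x : V) : Prop :=
  ∀ l', T.degree l' < 2 → T.dist l' (par T l x) < T.dist l' x → l' = l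

lemma arm_step (hT : T.IsTree) {l x : V} (hx : x ≠ l) (hy : par T l x ≠ l)
    (hd : T.degree (par T l x) = 2) (h : Arm T l (par T l x)) : Arm T l x := by
  intro l' hl' hdist
  obtain ⟨h1, h2⟩ := par_spec hT hx
  obtain ⟨h3, h4⟩ := par_spec hT hy
  have hne : par T l x ≠ l' := by rintro h'; rw [h'] at hd; omega
  obtain ⟨h5, h6⟩ := par_spec hT (r := l') hne
  have e1 : par T l' (par T l x) ≠ x := by intro h'; rw [h'] at h6; omega
  have e2 : par T l (par T l x) ≠ x := by intro h'; rw [h'] at h4; omega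
  by_cases e3 : par T l' (par T l x) = par T l (par T l x)
  · refine h l' hl' ?_
    rw [← e3]; omega
  · have := three_le_degree h1.symm h3 h5 e2.symm e1.symm (Ne.symm e3)
    omega

lemma arm_dich (hT : T.IsTree) {l : V} (hl : T.degree l < 2) (x : V) (hx : x ≠ l) :
    Arm T l x ∨ ∃ u, u ≠ l ∧ Arm T l u ∧ 3 ≤ T.degree u ∧
      T.dist x u < T.dist x (par T l u) := by
  induction hn : T.dist l x using Nat.strong_induction_on generalizing x with
  | _ n ih =>
    subst hn
    obtain ⟨h1, h2⟩ := par_spec hT hx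
    by_cases hy : par T l x = l
    · left
      intro l' hl' hdist
      by_contra hne
      rw [hy] at h1 hdist
      have := leaf_dist hT hl h1.symm hne
      omega
    · obtain ⟨h3, h4⟩ := par_spec hT hy
      have e2 : par T l (par T l x) ≠ x := by intro h'; rw [h'] at h4; omega
      rcases ih _ (by omega) (par T l x) hy rfl with h | ⟨u, hu1, hu2, hu3, hu4⟩
      · by_cases hd : T.degree (par T l x) = 2
        · exact Or.inl (arm_step hT hx hy hd h)
        · right
          refine ⟨_, hy, h, ?_, ?_⟩
          · have := two_le_degree h1.symm h3 e2.symm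
            omega
          · rw [dist_two hT h1 h3 e2.symm, dist_eq_one_iff_adj.mpr h1]; omega
      · right
        refine ⟨u, hu1, hu2, hu3, ?_⟩
        obtain ⟨h5, h6⟩ := par_spec hT hu1
        by_contra hc
        have hc' : T.dist x (par T l u) < T.dist x u := by
          have := dist_adj hT x h5
          omega
        obtain ⟨e3, e4⟩ := side_adj hT h1 h5 hu4 hc'
        rw [e3, e4] at h2
        omega

end Toolkit

section Moves

variable {V : Type*} [Fintype V] {G T : SimpleGraph V} {w : V → ℝ} {K : ℝ}

/-- An optimal spanning tree: fewest leaves first, then largest internal weight. -/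
structure Opt (G T : SimpleGraph V) (w : V → ℝ) (K : ℝ) : Prop where
  le : T ≤ G
  tree : T.IsTree
  cf : ClawFree G
  deg : ∀ v, 3 ≤ G.degree v
  hw : ∀ v, 0 ≤ w v
  hK : ∑ v, w v < K
  best : ∀ T' : SimpleGraph V, T' ≤ G → T'.IsTree →
    ∑ v, (if 2 ≤ T'.degree v then w v + K else 0) ≤ ∑ v, (if 2 ≤ T.degree v then w v + K else 0)

lemma Opt.lt (O : Opt G T w K) (v : V) : w v < K :=
  lt_of_le_of_lt (Finset.single_le_sum (fun i _ => O.hw i) (Finset.mem_univ v)) O.hK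

lemma Opt.pos (O : Opt G T w K) : 0 < K :=
  lt_of_le_of_lt (Finset.sum_nonneg (fun i _ => O.hw i)) O.hK

lemma gain (O : Opt G T w K) {T' : SimpleGraph V} (h1 : T' ≤ G) (h2 : T'.IsTree)
    (A S : Finset V) (hA : ∀ l ∈ A, T.degree l < 2 ∧ 2 ≤ T'.degree l)
    (hS : ∀ c, 2 ≤ T.degree c → T'.degree c < 2 → c ∈ S) :
    ∑ v ∈ A, (w v + K) ≤ ∑ v ∈ S, (w v + K) := by
  have hb := O.best T' h1 h2
  have e1 : ∀ B : Finset V, ∑ v ∈ B, (w v + K) = ∑ v, if v ∈ B then w v + K else 0 := by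
    intro B; rw [← Finset.sum_filter]; congr 1; ext; simp
  have : ∑ v, ((if 2 ≤ T.degree v then w v + K else 0) + (if v ∈ A then w v + K else 0)) ≤
      ∑ v, ((if 2 ≤ T'.degree v then w v + K else 0) + (if v ∈ S then w v + K else 0)) := by
    refine Finset.sum_le_sum fun c _ => ?_
    have hp := O.pos
    have hc := O.hw c
    have a1 := hA c
    have a2 := hS c
    split_ifs <;> first | linarith | (exfalso; grind)
  rw [Finset.sum_add_distrib, Finset.sum_add_distrib, ← e1, ← e1] at this
  linarith

lemma gain1 (O : Opt G T w K) {T' : SimpleGraph V} (h1 : T' ≤ G) (h2 : T'.IsTree)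
    {l y : V} (hl : T.degree l < 2) (hl' : 2 ≤ T'.degree l)
    (hS : ∀ c, 2 ≤ T.degree c → T'.degree c < 2 → c = y) : w l ≤ w y := by
  have := gain O h1 h2 {l} {y} (by grind) (by grind)
  simpa using this

lemma gain0 (O : Opt G T w K) {T' : SimpleGraph V} (h1 : T' ≤ G) (h2 : T'.IsTree)
    {l : V} (hl : T.degree l < 2) (hl' : 2 ≤ T'.degree l)
    (hS : ∀ c, 2 ≤ T.degree c → ¬ T'.degree c < 2) : False := by
  have := gain O h1 h2 {l} ∅ (by grind) (fun c h h' => absurd h' (hS c h))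
  have hp := O.pos
  have hc := O.hw l
  simp at this
  linarith

lemma gain2 (O : Opt G T w K) {T' : SimpleGraph V} (h1 : T' ≤ G) (h2 : T'.IsTree)
    {l l' y : V} (hne : l ≠ l') (hl : T.degree l < 2) (hl' : 2 ≤ T'.degree l)
    (hk : T.degree l' < 2) (hk' : 2 ≤ T'.degree l')
    (hS : ∀ c, 2 ≤ T.degree c → T'.degree c < 2 → c = y) : False := by
  have := gain O h1 h2 {l, l'} {y} (by grind) (by grind)
  rw [Finset.sum_pair hne, Finset.sum_singleton] at this
  have := O.hw l
  have := O.hw l'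
  have := O.lt y
  linarith

lemma gain22 (O : Opt G T w K) {T' : SimpleGraph V} (h1 : T' ≤ G) (h2 : T'.IsTree)
    {l l' y z : V} (hne : l ≠ l') (hyz : y ≠ z) (hl : T.degree l < 2) (hl' : 2 ≤ T'.degree l)
    (hk : T.degree l' < 2) (hk' : 2 ≤ T'.degree l')
    (hS : ∀ c, 2 ≤ T.degree c → T'.degree c < 2 → c = y ∨ c = z) : w l + w l' ≤ w y + w z := by
  have := gain O h1 h2 {l, l'} {y, z} (by grind) (by grind)
  rw [Finset.sum_pair hne, Finset.sum_pair hyz] at this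
  linarith

lemma one_le_degree {l p : V} (hp : T.Adj l p) : 1 ≤ T.degree l := by
  rw [← card_neighborFinset_eq_degree]
  exact Finset.card_pos.mpr ⟨p, by simpa using hp⟩

/-- First move. -/
lemma M1 (O : Opt G T w K) {l p x : V} (hl : T.degree l < 2) (hp : T.Adj l p)
    (hx : G.Adj l x) (hxp : x ≠ p) :
    T.degree (par T l x) = 2 ∧ w l ≤ w (par T l x) := by
  obtain ⟨h1, h2⟩ := par_spec O.tree hx.ne.symm
  set y := par T l x
  have hlx : ¬ T.Adj x l := fun h => hxp (leaf_nbr hl hp h.symm)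
  have hyl : y ≠ l := by intro h; rw [h] at h1; exact hlx h1
  have t : (xch T x y x l).IsTree := xch_tree O.tree h1
    (by rw [dist_self, dist_eq_one_iff_adj.mpr h1]; omega) (by omega)
  have le : xch T x y x l ≤ G := xch_le O.le hx.symm
  have d := xch_degree h1 hlx hx.ne.symm
  have hl1 := one_le_degree hp
  have hxy := h1.ne
  clear_value y
  have g : 2 ≤ (xch T x y x l).degree l := by
    have := d l; have := hx.ne; grind
  constructor
  · by_contra hd
    refine gain0 O le t hl g ?_
    intro c hc hc'
    have := d c; grind
  · refine gain1 O le t hl g ?_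
    intro c hc hc'
    have := d c; grind

/-- Second move: a leaf adjacent to both ends of a tree edge. -/
lemma M2 (O : Opt G T w K) {l p x y : V} (hl : T.degree l < 2) (hp : T.Adj l p)
    (hxy : T.Adj x y) (hx : G.Adj l x) (hy : G.Adj l y) (hyp : y ≠ p) : w l ≤ w p := by
  have t1 : (xch T l p l y).IsTree := xch_tree O.tree hp
    (by rw [dist_self, dist_eq_one_iff_adj.mpr hp]; omega)
    (by have := leaf_dist O.tree hl hp hy.ne.symm; omega)
  have le1 : xch T l p l y ≤ G := xch_le O.le hy
  have hly : ¬ T.Adj l y := fun h => hyp (leaf_nbr hl hp h)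
  have d1 := xch_degree hp hly hy.ne
  set T1 := xch T l p l y with hT1
  have a1 : T1.Adj x y := by
    rw [hT1, xch_adj]; left
    refine ⟨hxy, ?_⟩
    rw [ne_eq, Sym2.eq_iff]
    rintro (h | h)
    · exact hx.ne h.1.symm
    · exact hy.ne h.2.symm
  have a2 : T1.Adj l y := by rw [hT1, xch_adj]; right; exact ⟨rfl, hy.ne⟩
  have a3 : ¬ T1.Adj x l := fun h => no_tri t1 h a2 a1
  have t2 : (xch T1 x y x l).IsTree := xch_tree t1 a1
    (by rw [dist_self, dist_eq_one_iff_adj.mpr a1]; omega)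
    (by rw [dist_two t1 a2 a1.symm hx.ne, dist_eq_one_iff_adj.mpr a2]; omega)
  have le2 : xch T1 x y x l ≤ G := xch_le le1 hx.symm
  have d2 := xch_degree a1 a3 hx.ne.symm
  have hl1 := one_le_degree hp
  refine gain1 O le2 t2 hl ?_ ?_
  · have := d1 l; have := d2 l; have := hx.ne; have := hy.ne; have := hp.ne; grind
  · intro c hc hc'
    have := d1 c; have := d2 c; have := hx.ne; have := hy.ne; have := hp.ne; grind

lemma nonins (O : Opt G T w K) {l p : V} (hl : T.degree l < 2) (hp : T.Adj l p)
    (hb : w p < w l) {x y : V} (hxy : T.Adj x y) (hx : G.Adj l x) : ¬ G.Adj l y := by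
  intro hy
  have : w l ≤ w p := by
    by_cases h : y = p
    · exact M2 O hl hp hxy.symm hy hx (by rw [← h]; exact hxy.ne)
    · exact M2 O hl hp hxy hx hy h
  linarith

lemma exists_far (O : Opt G T w K) (l p : V) : ∃ x, G.Adj l x ∧ x ≠ p := by
  have := O.deg l
  exact exists_other p (by omega)

lemma exists_far2 (O : Opt G T w K) (l p : V) :
    ∃ x x', G.Adj l x ∧ x ≠ p ∧ G.Adj l x' ∧ x' ≠ p ∧ x ≠ x' := by
  obtain ⟨x, h1, h2⟩ := exists_far O l p
  obtain ⟨x', h3, h4, h5⟩ := exists_other2 p x (O.deg l)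
  exact ⟨x, x', h1, h2, h3, h4, h5.symm⟩

/-- A bad leaf hangs at a vertex of degree two. -/
lemma M5 (O : Opt G T w K) {l p : V} (hl : T.degree l < 2) (hp : T.Adj l p)
    (h3 : 3 ≤ T.degree p) : w l ≤ w p := by
  obtain ⟨x, hx, hxp⟩ := exists_far O l p
  obtain ⟨h1, h2⟩ := par_spec O.tree hxp.symm
  have hlx := leaf_dist O.tree hl hp hx.ne.symm
  set q1 := par T x p
  have hq1 : q1 ≠ l := by intro h; rw [h] at h2; omega
  obtain ⟨q2, h4, h5, h6⟩ := exists_other2 l q1 h3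
  have nq : ∀ q, T.Adj p q → q ≠ l → ¬ G.Adj l q := by
    intro q hq hql hlq
    have hd : T.dist l p < T.dist l q := by
      rw [dist_two O.tree hp hq hql.symm, dist_eq_one_iff_adj.mpr hp]; omega
    have := (M1 O hl hp hlq hq.ne.symm).1
    rw [par_eq O.tree hq.symm hd] at this
    omega
  have hqq : G.Adj q1 q2 := by
    rcases O.cf p l q1 q2 (O.le hp.symm) (O.le h1) (O.le h4) hq1.symm h5.symm h6.symm with h | h | h
    · exact absurd h (nq _ h1 hq1)
    · exact absurd h (nq _ h4 h5)
    · exact h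
  have n1 : ¬ T.Adj q1 q2 := no_tri O.tree h1.symm h4
  have t1 : (xch T p q2 q1 q2).IsTree := xch_tree O.tree h4
    (by rw [dist_two O.tree h1.symm h4 h6.symm, dist_eq_one_iff_adj.mpr h1.symm]; omega)
    (by rw [dist_self, dist_eq_one_iff_adj.mpr h4.symm]; omega)
  have le1 : xch T p q2 q1 q2 ≤ G := xch_le O.le hqq
  have d1 := xch_degree h4 n1 h6.symm
  have hpl := hp.ne
  have hpq1 := h1.ne
  have hpq2 := h4.ne
  have hlx' := hx.ne
  have hnlx : ¬ T.Adj l x := fun h => hxp (leaf_nbr hl hp h)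
  set T1 := xch T p q2 q1 q2 with hT1
  have a1 : T1.Adj p q1 := by
    rw [hT1, xch_adj, ne_eq, Sym2.eq_iff]; left
    exact ⟨h1, by grind⟩
  have a2 : T1.Adj l p := by
    rw [hT1, xch_adj, ne_eq, Sym2.eq_iff]; left
    exact ⟨hp, by grind⟩
  have a3 : ¬ T1.Adj l x := by
    rw [hT1, xch_adj, Sym2.eq_iff]; grind
  have av : T1.dist x q1 < T1.dist x p := by
    refine avoid O.tree t1 (by omega) a1 ?_
    intro c d hcd hc hd
    rw [hT1, xch_adj, ne_eq, Sym2.eq_iff]; left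
    exact ⟨hcd, by grind⟩
  have t2 : (xch T1 p q1 l x).IsTree := xch_tree t1 a1
    (by rw [dist_two t1 a2 a1 hq1.symm, dist_eq_one_iff_adj.mpr a2]; omega) av
  have le2 : xch T1 p q1 l x ≤ G := xch_le le1 hx
  have d2 := xch_degree a1 a3 hx.ne
  have hl1 := one_le_degree hp
  refine gain1 O le2 t2 hl ?_ ?_
  · have := d1 l; have := d2 l; grind
  · intro c hc hc'
    have := d1 c; have := d2 c; grind

/-- Far neighbours of a bad leaf have degree two. -/
lemma degX (O : Opt G T w K) {l p x : V} (hl : T.degree l < 2) (hp : T.Adj l p)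
    (hb : w p < w l) (hx : G.Adj l x) (hxp : x ≠ p) (hx2 : 2 ≤ T.degree x) :
    T.degree x = 2 ∧ w l ≤ w x := by
  obtain ⟨h1, h2⟩ := par_spec O.tree hx.ne.symm
  set y := par T l x
  obtain ⟨z, hz, hzy⟩ := exists_other y hx2
  have hlx : ¬ T.Adj x l := fun h => hxp (leaf_nbr hl hp h.symm)
  have hyl : y ≠ l := by intro h; rw [h] at h1; exact hlx h1
  have hzl : z ≠ l := by intro h; rw [h] at hz; exact hlx hz
  have hyz : G.Adj y z := by
    rcases O.cf x l y z hx.symm (O.le h1) (O.le hz) hyl.symm hzl.symm hzy.symm with h | h | h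
    · exact absurd h (nonins O hl hp hb h1 hx)
    · exact absurd h (nonins O hl hp hb hz hx)
    · exact h
  have n1 : ¬ T.Adj y z := no_tri O.tree h1.symm hz
  have t1 : (xch T x z y z).IsTree := xch_tree O.tree hz
    (by rw [dist_two O.tree h1.symm hz hzy.symm, dist_eq_one_iff_adj.mpr h1.symm]; omega)
    (by rw [dist_self, dist_eq_one_iff_adj.mpr hz.symm]; omega)
  have le1 : xch T x z y z ≤ G := xch_le O.le hyz
  have d1 := xch_degree hz n1 hzy.symm
  have hxy' := h1.ne
  have hxz' := hz.ne
  have hlx' := hx.ne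
  set T1 := xch T x z y z with hT1
  have a1 : T1.Adj x y := by
    rw [hT1, xch_adj, ne_eq, Sym2.eq_iff]; left
    exact ⟨h1, by grind⟩
  have a3 : ¬ T1.Adj x l := by
    rw [hT1, xch_adj, Sym2.eq_iff]; grind
  have av : T1.dist l y < T1.dist l x := by
    refine avoid O.tree t1 (by omega) a1 ?_
    intro c d hcd hc hd
    rw [hT1, xch_adj, ne_eq, Sym2.eq_iff]; left
    exact ⟨hcd, by grind⟩
  have t2 : (xch T1 x y x l).IsTree := xch_tree t1 a1
    (by rw [dist_self, dist_eq_one_iff_adj.mpr a1]; omega) av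
  have le2 : xch T1 x y x l ≤ G := xch_le le1 hx.symm
  have d2 := xch_degree a1 a3 hx.ne.symm
  have hl1 := one_le_degree hp
  have g : 2 ≤ (xch T1 x y x l).degree l := by
    have := d1 l; have := d2 l; grind
  constructor
  · by_contra hd
    refine gain0 O le2 t2 hl g ?_
    intro c hc hc'
    have := d1 c; have := d2 c; grind
  · refine gain1 O le2 t2 hl g ?_
    intro c hc hc'
    have := d1 c; have := d2 c; grind

/-- Exchange through a branch vertex. -/
lemma branch (O : Opt G T w K) {l p x u : V} (hl : T.degree l < 2) (hp : T.Adj l p)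
    (hp2 : T.degree p = 2) (hx : G.Adj l x) (hxp : x ≠ p) (hx2 : 2 ≤ T.degree x)
    (hu : u ≠ l) (hu3 : 3 ≤ T.degree u) (hd : T.dist x u < T.dist x (par T l u)) :
    T.degree (par T l u) = 2 ∧ w l ≤ w (par T l u) := by
  obtain ⟨h1, h2⟩ := par_spec O.tree hu
  set v := par T l u
  have hvl : v ≠ l := by
    intro h; rw [h] at h1
    have := leaf_nbr hl hp h1.symm
    rw [this] at hu3; omega
  have hlx : ¬ T.Adj x l := fun h => hxp (leaf_nbr hl hp h.symm)
  have t : (xch T u v x l).IsTree := xch_tree O.tree h1 hd (by omega)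
  have le : xch T u v x l ≤ G := xch_le O.le hx.symm
  have d := xch_degree h1 hlx hx.ne.symm
  have hl1 := one_le_degree hp
  have huv := h1.ne
  clear_value v
  have g : 2 ≤ (xch T u v x l).degree l := by
    have := d l; have := hx.ne; grind
  constructor
  · by_contra hd
    refine gain0 O le t hl g ?_
    intro c hc hc'
    have := d c; grind
  · refine gain1 O le t hl g ?_
    intro c hc hc'
    have := d c; grind

end Moves

section Ham

variable {V : Type*} [Fintype V] {G T : SimpleGraph V} {w : V → ℝ} {K : ℝ}

lemma exists_nbr (O : Opt G T w K) (l : V) : ∃ p, T.Adj l p := by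
  obtain ⟨x, hx, -⟩ := exists_far O l l
  obtain ⟨p, hp, -⟩ := exists_closer O.tree (r := x) hx.ne
  exact ⟨p, hp⟩

lemma leaf_not_adj (O : Opt G T w K) {l l' : V} (hl : T.degree l < 2) (hl' : T.degree l' < 2) :
    ¬ T.Adj l l' := by
  intro h
  obtain ⟨z, hz, hz'⟩ := exists_far O l l'
  have h1 := leaf_dist O.tree hl h hz.ne.symm
  have h2 := leaf_dist O.tree hl' h.symm hz'
  omega

/-- Exchange along an edge separating two adjacent leaves. -/
lemma ham_step (O : Opt G T w K) {l l' x : V} (hl : T.degree l < 2) (hl' : T.degree l' < 2)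
    (hne : G.Adj l l') (hx : x ≠ l) (hd : T.dist l' x < T.dist l' (par T l x)) :
    T.degree x < 3 ∧ w l + w l' ≤ w x + w (par T l x) := by
  obtain ⟨h1, h2⟩ := par_spec O.tree hx
  set y := par T l x
  have hn := leaf_not_adj O hl hl'
  have t : (xch T y x l l').IsTree := xch_tree O.tree h1.symm (by omega) hd
  have le : xch T y x l l' ≤ G := xch_le O.le hne
  have d := xch_degree h1.symm hn hne.ne
  obtain ⟨p, hp⟩ := exists_nbr O l
  obtain ⟨p', hp'⟩ := exists_nbr O l'
  have e1 := one_le_degree hp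
  have e2 := one_le_degree hp'
  have hxy := h1.ne
  have hll := hne.ne
  have hyl' : y ≠ l' := by intro h; rw [h, dist_self] at hd; omega
  clear_value y
  have dl := d l
  have dl' := d l'
  by_cases hyl : y = l
  · have hxl' : x ≠ l' := by intro h; rw [hyl, h] at h1; exact hn h1.symm
    have g : 2 ≤ (xch T y x l l').degree l' := by grind
    constructor
    · by_contra h3
      refine gain0 O le t hl' g ?_
      intro c hc hc'
      have := d c; grind
    · have : w l' ≤ w x := by
        refine gain1 O le t hl' g ?_
        intro c hc hc'
        have := d c; grind
      rw [hyl]; linarith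
  · have g : 2 ≤ (xch T y x l l').degree l := by grind
    by_cases hxl' : x = l'
    · refine ⟨by rw [hxl']; omega, ?_⟩
      have : w l ≤ w y := by
        refine gain1 O le t hl g ?_
        intro c hc hc'
        have := d c; grind
      rw [hxl']; linarith
    · have g' : 2 ≤ (xch T y x l l').degree l' := by grind
      constructor
      · by_contra h3
        refine gain2 O le t hll hl g hl' g' (y := y) ?_
        intro c hc hc'
        have := d c; grind
      · refine gain22 O le t hll hxy hl g hl' g' ?_
        intro c hc hc'
        have := d c; grind

lemma ham (O : Opt G T w K) {l l' : V} (hl : T.degree l < 2) (hl' : T.degree l' < 2)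
    (hne : G.Adj l l') :
    (∀ k, T.degree k < 2 → k = l ∨ k = l') ∧
      (Fintype.card V : ℝ) * (w l + w l') ≤ 2 * ∑ v, w v := by
  have far : ∀ x, x ≠ l → Arm T l x → T.dist l' x < T.dist l' (par T l x) := by
    intro x hx ha
    by_contra hc
    have h1 := dist_adj O.tree l' (par_spec O.tree hx).1
    exact hne.ne (ha l' hl' (by omega)).symm
  have arm : ∀ x, x ≠ l → Arm T l x := by
    intro x hx
    rcases arm_dich O.tree hl x hx with h | ⟨u, hu, ha, hu3, -⟩
    · exact h
    · have := (ham_step O hl hl' hne hu (far u hu ha)).1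
      omega
  constructor
  · intro k hk
    by_contra hc
    push Not at hc
    have h1 := (par_spec O.tree hne.ne.symm).1
    have h2 := leaf_dist O.tree hl' h1 hc.2
    exact hc.1 (arm l' hne.ne.symm k hk (by omega))
  · have hs : ∑ x ∈ Finset.univ.erase l, (w l + w l') ≤
        ∑ x ∈ Finset.univ.erase l, (w x + w (par T l x)) := by
      refine Finset.sum_le_sum fun x hx => ?_
      have hx' : x ≠ l := by simpa using hx
      exact (ham_step O hl hl' hne hx' (far x hx' (arm x hx'))).2
    have hi : ∑ x ∈ Finset.univ.erase l, w (par T l x) ≤ ∑ y ∈ Finset.univ.erase l', w y := by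
      rw [← Finset.sum_image (g := par T l) (f := w)]
      · refine Finset.sum_le_sum_of_subset_of_nonneg ?_ (fun i _ _ => O.hw i)
        intro y hy
        obtain ⟨x, hx, rfl⟩ := Finset.mem_image.mp hy
        have hx' : x ≠ l := by simpa using hx
        have := far x hx' (arm x hx')
        simp only [Finset.mem_erase, Finset.mem_univ, and_true]
        intro h
        rw [h, dist_self] at this
        omega
      · intro x hx x' hx' he
        have hx : x ≠ l := by simpa using hx
        have hx' : x' ≠ l := by simpa using hx'
        have h1 := far x hx (arm x hx)
        have h2 := far x' hx' (arm x' hx')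
        have h3 := (par_spec O.tree hx).1
        have h4 := (par_spec O.tree hx').1
        rw [← he] at h2 h4
        exact closer_unique O.tree h3.symm h4.symm h1 h2
    rw [Finset.sum_const, Finset.sum_add_distrib, Finset.card_erase_of_mem (Finset.mem_univ l),
      Finset.card_univ, nsmul_eq_mul] at hs
    have e1 := Finset.add_sum_erase Finset.univ w (Finset.mem_univ l)
    have e2 := Finset.add_sum_erase Finset.univ w (Finset.mem_univ l')
    have hpos : 1 ≤ Fintype.card V := Fintype.card_pos_iff.mpr ⟨l⟩
    rw [Nat.cast_sub hpos] at hs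
    push_cast at hs
    linarith

end Ham

section Charge

variable {V : Type*} [Fintype V] {G T : SimpleGraph V} {w : V → ℝ} {K : ℝ}

/-- Admissible charging vertices of a leaf. -/
def Elt (G T : SimpleGraph V) (w : V → ℝ) (l x : V) : Prop :=
  x ≠ l ∧ 2 ≤ T.degree x ∧ T.degree (par T l x) = 2 ∧ w l ≤ w (par T l x) ∧
    ((G.Adj l x ∧ ¬ T.Adj l x ∧ ∀ z, T.Adj x z → z ≠ par T l x → ¬ G.Adj l z) ∨ Arm T l x)

lemma good_elt (O : Opt G T w K) (ind : ∀ l l', T.degree l < 2 → T.degree l' < 2 → ¬ G.Adj l l')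
    {l p : V} (hl : T.degree l < 2) (hp : T.Adj l p) : ∃ x, Elt G T w l x ∧ par T l x ≠ p := by
  set S : Finset V := Finset.univ.filter (fun x => G.Adj l x ∧ x ≠ p ∧ par T l x ≠ p) with hS
  have hne : S.Nonempty := by
    obtain ⟨x, x', h1, h2, h3, h4, h5⟩ := exists_far2 O l p
    by_cases e1 : par T l x = p
    · by_cases e2 : par T l x' = p
      · exfalso
        have a1 := (par_spec O.tree h1.ne.symm).1
        have a2 := (par_spec O.tree h3.ne.symm).1
        have a3 := (M1 O hl hp h1 h2).1
        rw [e1] at a1 a3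
        rw [e2] at a2
        have := three_le_degree hp.symm a1.symm a2.symm h1.ne h3.ne h5
        omega
      · exact ⟨x', by simp [hS, h3, h4, e2]⟩
    · exact ⟨x, by simp [hS, h1, h2, e1]⟩
  obtain ⟨x, hx, hmax⟩ := Finset.exists_max_image S (fun x => T.dist l x) hne
  have hx' : G.Adj l x ∧ x ≠ p ∧ par T l x ≠ p := by simpa [hS] using hx
  obtain ⟨h1, h2, h3⟩ := hx'
  obtain ⟨m1, m2⟩ := M1 O hl hp h1 h2
  refine ⟨x, ⟨h1.ne.symm, ?_, m1, m2, Or.inl ⟨h1, ?_, ?_⟩⟩, h3⟩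
  · by_contra hc
    exact ind l x hl (by omega) h1
  · intro h; exact h2 (leaf_nbr hl hp h)
  · intro z hz hzy hlz
    have hd : T.dist l z = T.dist l x + 1 := by
      rcases dist_adj O.tree l hz with h | h
      · exact absurd (par_eq O.tree hz (by omega)).symm hzy
      · exact h
    have hxl := O.tree.connected.pos_dist_of_ne h1.ne
    have hzp : z ≠ p := by
      intro h
      rw [h, dist_eq_one_iff_adj.mpr hp] at hd
      omega
    have hpz : par T l z = x := par_eq O.tree hz.symm (by omega)
    have := hmax z (by simp [hS, hlz, hzp, hpz, h2])
    omega

lemma arm_next (O : Opt G T w K) {l p x : V} (hl : T.degree l < 2) (hp : T.Adj l p)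
    (hb : w p < w l) (hx : G.Adj l x) (hxp : x ≠ p) (hx2 : 2 ≤ T.degree x) (ha : Arm T l x) :
    ∃ z, T.Adj x z ∧ z ≠ l ∧ par T l z = x ∧ Arm T l z ∧ ¬ G.Adj l z := by
  obtain ⟨z, hz, hzy⟩ := exists_other (par T l x) hx2
  have hd : T.dist l z = T.dist l x + 1 := by
    rcases dist_adj O.tree l hz with h | h
    · exact absurd (par_eq O.tree hz (by omega)).symm hzy
    · exact h
  have hpz : par T l z = x := par_eq O.tree hz.symm (by omega)
  have hzl : z ≠ l := by intro h; rw [h, dist_self] at hd; omega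
  have hdx := (degX O hl hp hb hx hxp hx2).1
  refine ⟨z, hz, hzl, hpz, ?_, nonins O hl hp hb hz hx⟩
  refine arm_step O.tree hzl ?_ ?_ ?_
  · rw [hpz]; exact hx.ne.symm
  · rw [hpz]; exact hdx
  · rw [hpz]; exact ha

lemma bad_elt (O : Opt G T w K) (ind : ∀ l l', T.degree l < 2 → T.degree l' < 2 → ¬ G.Adj l l')
    {l p : V} (hl : T.degree l < 2) (hp : T.Adj l p) (hb : w p < w l) :
    ∃ A : Finset V, A.card = 3 ∧ ∀ x ∈ A, Elt G T w l x := by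
  obtain ⟨x, x', h1, h2, h3, h4, h5⟩ := exists_far2 O l p
  have nl : ∀ y, G.Adj l y → 2 ≤ T.degree y := by
    intro y hy
    by_contra hc
    exact ind l y hl (by omega) hy
  have hel : ∀ y, G.Adj l y → y ≠ p → Elt G T w l y := by
    intro y hy hyp
    obtain ⟨m1, m2⟩ := M1 O hl hp hy hyp
    exact ⟨hy.ne.symm, nl y hy, m1, m2, Or.inl ⟨hy, fun h => hyp (leaf_nbr hl hp h),
      fun z hz _ => nonins O hl hp hb hz hy⟩⟩
  suffices h : ∃ u, Elt G T w l u ∧ u ≠ x ∧ u ≠ x' by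
    obtain ⟨u, hu, hux, hux'⟩ := h
    refine ⟨{x, x', u}, Finset.card_eq_three.mpr ⟨x, x', u, h5, hux.symm, hux'.symm, rfl⟩, ?_⟩
    intro y hy
    simp only [Finset.mem_insert, Finset.mem_singleton] at hy
    rcases hy with rfl | rfl | rfl
    · exact hel _ h1 h2
    · exact hel _ h3 h4
    · exact hu
  have hp2 : T.degree p = 2 := by
    obtain ⟨a1, a2⟩ := par_spec O.tree h2.symm
    have a3 := leaf_dist O.tree hl hp h1.ne.symm
    have := two_le_degree hp.symm a1 (by intro h; rw [← h] at a2; omega)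
    by_contra hc
    have := M5 O hl hp (by omega)
    linarith
  have dx := (degX O hl hp hb h1 h2 (nl x h1)).1
  have dx' := (degX O hl hp hb h3 h4 (nl x' h3)).1
  have key : ∀ y, G.Adj l y → y ≠ p → ¬ Arm T l y → ∃ u, Elt G T w l u ∧ u ≠ x ∧ u ≠ x' := by
    intro y hy hyp hna
    rcases arm_dich O.tree hl y hy.ne.symm with h | ⟨u, hu, ha, hu3, hd⟩
    · exact absurd h hna
    · obtain ⟨b1, b2⟩ := branch O hl hp hp2 hy hyp (nl y hy) hu hu3 hd
      refine ⟨u, ⟨hu, by omega, b1, b2, Or.inr ha⟩, ?_, ?_⟩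
      · intro h; rw [h] at hu3; omega
      · intro h; rw [h] at hu3; omega
  by_cases c1 : Arm T l x
  · by_cases c2 : Arm T l x'
    · obtain ⟨z, z1, z2, z3, z4, z5⟩ := arm_next O hl hp hb h1 h2 (nl x h1) c1
      obtain ⟨z', z1', z2', z3', z4', z5'⟩ := arm_next O hl hp hb h3 h4 (nl x' h3) c2
      by_cases dz : 2 ≤ T.degree z
      · refine ⟨z, ⟨z2, dz, by rw [z3]; exact dx, ?_, Or.inr z4⟩, ?_, ?_⟩
        · rw [z3]; exact (degX O hl hp hb h1 h2 (nl x h1)).2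
        · rintro rfl; exact z5 h1
        · rintro rfl; exact z5 h3
      · by_cases dz' : 2 ≤ T.degree z'
        · refine ⟨z', ⟨z2', dz', by rw [z3']; exact dx', ?_, Or.inr z4'⟩, ?_, ?_⟩
          · rw [z3']; exact (degX O hl hp hb h3 h4 (nl x' h3)).2
          · rintro rfl; exact z5' h1
          · rintro rfl; exact z5' h3
        · exfalso
          have hzz : z' ≠ z := by
            rintro rfl
            exact h5 (z3.symm.trans z3')
          have := leaf_dist O.tree (by omega) z1.symm hzz
          exact z2' (z4 z' (by omega) (by rw [z3]; omega))
    · exact key x' h3 h4 c2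
  · exact key x h1 h2 c1

lemma claim2 (O : Opt G T w K) (ind : ∀ l l', T.degree l < 2 → T.degree l' < 2 → ¬ G.Adj l l')
    {l l' x : V} (hl : T.degree l < 2) (hl' : T.degree l' < 2) (h : Elt G T w l x)
    (h' : Elt G T w l' x) (he : par T l x = par T l' x) : l = l' := by
  obtain ⟨a1, a2, a3, a4, a5⟩ := h
  obtain ⟨b1, b2, b3, b4, b5⟩ := h'
  have s1 := par_spec O.tree a1
  have s2 := par_spec O.tree b1
  rcases a5 with ⟨a5, a6, a7⟩ | a5
  · rcases b5 with ⟨b5, b6, b7⟩ | b5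
    · by_contra hne
      obtain ⟨z, hz, hzy⟩ := exists_other (par T l x) a2
      have n1 : l ≠ z := by rintro rfl; exact a6 hz.symm
      have n2 : l' ≠ z := by rintro rfl; exact b6 hz.symm
      rcases O.cf x l l' z a5.symm b5.symm (O.le hz) hne n1 n2 with h | h | h
      · exact ind l l' hl hl' h
      · exact a7 z hz hzy h
      · exact b7 z hz (by rw [← he]; exact hzy) h
    · exact b5 l hl (by rw [← he]; omega)
  · exact (a5 l' hl' (by rw [he]; omega)).symm

lemma claim3 (O : Opt G T w K) {l l' p x : V} (hl : T.degree l < 2) (hl' : T.degree l' < 2)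
    (hp : T.Adj l p) (h : Elt G T w l' x) (he : par T l' x = p) : l' = l := by
  obtain ⟨a1, a2, a3, a4, a5⟩ := h
  have s1 := par_spec O.tree a1
  rw [he] at a3 s1
  rcases side_p O.tree hl hp a3 s1.1.symm (by rintro rfl; omega) (x := l') (by omega) with h | h
  · exact h
  · rw [h] at hl'; omega

lemma p_inj (O : Opt G T w K) (ind : ∀ l l', T.degree l < 2 → T.degree l' < 2 → ¬ G.Adj l l')
    {l l' p : V} (hl : T.degree l < 2) (hl' : T.degree l' < 2)
    (hp : T.Adj l p) (hp' : T.Adj l' p) : l = l' := by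
  by_contra hne
  obtain ⟨x, hx, hxp⟩ := exists_far O l p
  have hxl' : x ≠ l' := by rintro rfl; exact ind _ _ hl hl' hx
  obtain ⟨s1, s2⟩ := par_spec O.tree hxp.symm
  have e1 := leaf_dist O.tree hl hp hx.ne.symm
  have e2 := leaf_dist O.tree hl' hp' hxl'
  set q := par T x p
  have q1 : l ≠ q := by intro h; rw [← h] at s2; omega
  have q2 : l' ≠ q := by intro h; rw [← h] at s2; omega
  have h3 := three_le_degree hp.symm hp'.symm s1 hne q1 q2
  have key : ∀ k, T.degree k < 2 → T.Adj k p → k ≠ q → ¬ G.Adj k q := by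
    intro k hk hkp hkq hadj
    have := (M1 O hk hkp hadj s1.ne.symm).1
    rw [par_eq O.tree s1.symm (by
      rw [dist_two O.tree hkp s1 hkq, dist_eq_one_iff_adj.mpr hkp]; omega)] at this
    omega
  rcases O.cf p l l' q (O.le hp.symm) (O.le hp'.symm) (O.le s1) hne q1 q2 with h | h | h
  · exact ind _ _ hl hl' h
  · exact key l hl hp q1 h
  · exact key l' hl' hp' q2 h

lemma sum_fib {ι : Type*} (I : Finset ι) (f : ι → V) (w : V → ℝ) :
    ∑ i ∈ I, w (f i) = ∑ v, ((I.filter (fun i => f i = v)).card : ℝ) * w v := by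
  rw [← Finset.sum_fiberwise I f]
  refine Finset.sum_congr rfl fun v _ => ?_
  rw [← nsmul_eq_mul, ← Finset.sum_const]
  refine Finset.sum_congr rfl fun i hi => ?_
  rw [(Finset.mem_filter.mp hi).2]

lemma charging (O : Opt G T w K)
    (ind : ∀ l l', T.degree l < 2 → T.degree l' < 2 → ¬ G.Adj l l') :
    3 * ∑ v, (if T.degree v < 2 then w v else 0) ≤
      2 * ∑ v, (if 2 ≤ T.degree v then w v else 0) := by
  choose P hP using exists_nbr O
  have hA : ∀ l, ∃ A : Finset V, T.degree l < 2 → (∀ x ∈ A, Elt G T w l x) ∧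
      ((w l ≤ w (P l) ∧ A.card = 1 ∧ ∀ x ∈ A, par T l x ≠ P l) ∨
        (w (P l) < w l ∧ A.card = 3)) := by
    intro l
    by_cases hl : T.degree l < 2
    · by_cases hg : w l ≤ w (P l)
      · obtain ⟨x, h1, h2⟩ := good_elt O ind hl (hP l)
        refine ⟨{x}, fun _ => ⟨?_, Or.inl ⟨hg, by simp, ?_⟩⟩⟩
        · simpa using h1
        · simpa using h2
      · push Not at hg
        obtain ⟨A, h1, h2⟩ := bad_elt O ind hl (hP l) hg
        exact ⟨A, fun _ => ⟨h2, Or.inr ⟨hg, h1⟩⟩⟩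
    · exact ⟨∅, fun h => absurd h hl⟩
  choose A hA using hA
  set L : Finset V := Finset.univ.filter (fun l => T.degree l < 2) with hL
  have mL : ∀ l, l ∈ L ↔ T.degree l < 2 := by intro l; simp only [hL, Finset.mem_filter, Finset.mem_univ, true_and]
  set Gd : Finset V := L.filter (fun l => w l ≤ w (P l)) with hGd
  set Q : Finset (Σ _ : V, V) := L.sigma A with hQ
  have s1 : 3 * ∑ l ∈ L, w l ≤
      2 * ∑ l ∈ Gd, w (P l) + ∑ q ∈ Q, w (par T q.1 q.2) := by
    rw [hQ, Finset.sum_sigma]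
    have e1 : ∑ l ∈ Gd, w (P l) = ∑ l ∈ L, if w l ≤ w (P l) then w (P l) else 0 := by
      rw [hGd, Finset.sum_filter]
    rw [e1, Finset.mul_sum, Finset.mul_sum, ← Finset.sum_add_distrib]
    refine Finset.sum_le_sum fun l hl => ?_
    obtain ⟨h1, h2⟩ := hA l ((mL l).mp hl)
    have h3 : (A l).card • w l ≤ ∑ x ∈ A l, w (par T l x) :=
      Finset.card_nsmul_le_sum _ _ _ (fun x hx => (h1 x hx).2.2.2.1)
    rw [nsmul_eq_mul] at h3
    rcases h2 with ⟨h4, h5, -⟩ | ⟨h4, h5⟩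
    · rw [h5] at h3
      rw [if_pos h4]
      push_cast at h3
      linarith
    · rw [h5] at h3
      rw [if_neg (not_le.mpr h4)]
      push_cast at h3
      linarith
  have e2 : ∑ v, (if T.degree v < 2 then w v else 0) = ∑ l ∈ L, w l := by
    rw [hL, Finset.sum_filter]
  rw [sum_fib Gd, sum_fib Q (fun q => par T q.1 q.2), Finset.mul_sum (s := Finset.univ),
    ← Finset.sum_add_distrib] at s1
  rw [e2]
  refine s1.trans ?_
  rw [Finset.mul_sum]
  refine Finset.sum_le_sum fun v _ => ?_
  have memQ : ∀ q : (Σ _ : V, V), q ∈ Q → T.degree q.1 < 2 ∧ Elt G T w q.1 q.2 ∧ q.2 ∈ A q.1 := by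
    intro q hq
    rw [hQ, Finset.mem_sigma] at hq
    have := (mL _).mp hq.1
    exact ⟨this, (hA _ this).1 _ hq.2, hq.2⟩
  have memG : ∀ l, l ∈ Gd → T.degree l < 2 ∧ w l ≤ w (P l) := by
    intro l hl
    rw [hGd, Finset.mem_filter] at hl
    exact ⟨(mL _).mp hl.1, hl.2⟩
  set FG := Gd.filter (fun l => P l = v) with hFG
  set FQ := Q.filter (fun q => par T q.1 q.2 = v) with hFQ
  have main : (2 ≤ T.degree v ∨ (FG = ∅ ∧ FQ = ∅)) ∧ 2 * FG.card + FQ.card ≤ 2 := by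
    constructor
    · by_cases hv : 2 ≤ T.degree v
      · exact Or.inl hv
      · right
        constructor
        · rw [Finset.eq_empty_iff_forall_notMem]
          intro l hl
          rw [hFG, Finset.mem_filter] at hl
          have := hP l
          rw [hl.2] at this
          exact leaf_not_adj O (memG l hl.1).1 (by omega) this
        · rw [Finset.eq_empty_iff_forall_notMem]
          intro q hq
          rw [hFQ, Finset.mem_filter] at hq
          have := (memQ q hq.1).2.1.2.2.1
          rw [hq.2] at this
          omega
    · by_cases hg : FG.Nonempty
      · obtain ⟨l, hl⟩ := hg
        have hl' := hl
        rw [hFG, Finset.mem_filter] at hl'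
        have hlv : T.Adj l v := by rw [← hl'.2]; exact hP l
        have hld := (memG l hl'.1).1
        have c1 : FG.card ≤ 1 := by
          have : Nonempty V := ⟨l⟩
          rw [Finset.card_le_one_iff_subset_singleton]
          refine ⟨l, fun k hk => ?_⟩
          rw [hFG, Finset.mem_filter] at hk
          have hkv : T.Adj k v := by rw [← hk.2]; exact hP k
          rw [Finset.mem_singleton]
          exact p_inj O ind (memG k hk.1).1 hld hkv hlv
        have c2 : FQ = ∅ := by
          rw [Finset.eq_empty_iff_forall_notMem]
          rintro ⟨k, x⟩ hq
          rw [hFQ, Finset.mem_filter] at hq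
          obtain ⟨m1, m2, m3⟩ := memQ _ hq.1
          simp only at m1 m2 m3 hq
          have hkl := claim3 O hld m1 hlv m2 hq.2
          subst hkl
          rcases (hA k hld).2 with h | h
          · exact h.2.2 x m3 (hq.2.trans hl'.2.symm)
          · linarith [(memG k hl'.1).2]
        rw [c2, Finset.card_empty]
        omega
      · rw [Finset.not_nonempty_iff_eq_empty] at hg
        rw [hg, Finset.card_empty]
        by_cases hq : FQ.Nonempty
        · obtain ⟨q, hq⟩ := hq
          rw [hFQ, Finset.mem_filter] at hq
          have hd := (memQ q hq.1).2.1.2.2.1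
          rw [hq.2] at hd
          have : FQ.card ≤ (T.neighborFinset v).card := by
            refine Finset.card_le_card_of_injOn (fun q => q.2) ?_ ?_
            · intro q hq
              rw [Finset.mem_coe, hFQ, Finset.mem_filter] at hq
              have := (par_spec O.tree (memQ q hq.1).2.1.1).1
              rw [hq.2] at this
              rw [Finset.mem_coe, mem_neighborFinset]
              exact this.symm
            · rintro ⟨k, x⟩ hq ⟨k', x'⟩ hq' he
              simp only at he
              subst he
              rw [Finset.mem_coe, hFQ, Finset.mem_filter] at hq hq'
              have e := claim2 O ind (memQ _ hq.1).1 (memQ _ hq'.1).1 (memQ _ hq.1).2.1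
                (memQ _ hq'.1).2.1 (hq.2.trans hq'.2.symm)
              simp only at e
              rw [e]
          rw [card_neighborFinset_eq_degree, hd] at this
          omega
        · rw [Finset.not_nonempty_iff_eq_empty] at hq
          rw [hq]; simp
  obtain ⟨m1, m2⟩ := main
  have m2' : (2 * (FG.card : ℝ) + FQ.card) ≤ 2 := by exact_mod_cast m2
  by_cases hv : 2 ≤ T.degree v
  · rw [if_pos hv]
    have := mul_le_mul_of_nonneg_right m2' (O.hw v)
    linarith
  · rw [if_neg hv]
    rcases m1 with h | ⟨h, h'⟩
    · exact absurd h hv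
    · rw [h, h']; simp

lemma exists_opt (hconn : G.Connected) (hcf : ClawFree G) (hdeg : ∀ v : V, 3 ≤ G.degree v)
    (hw : ∀ v : V, 0 ≤ w v) : ∃ (T : SimpleGraph V) (K : ℝ), Opt G T w K := by
  obtain ⟨T₀, h1, h2⟩ := hconn.exists_isTree_le
  obtain ⟨T, hT, hmax⟩ := Set.exists_max_image {T : SimpleGraph V | T ≤ G ∧ T.IsTree}
    (fun T => ∑ v, (if 2 ≤ T.degree v then w v + (∑ v, w v + 1) else 0)) (Set.toFinite _)
    ⟨T₀, h1, h2⟩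
  exact ⟨T, ∑ v, w v + 1, hT.1, hT.2, hcf, hdeg, hw, by linarith, fun T' a b => hmax T' ⟨a, b⟩⟩

end Charge

end ClawTree

/-- Every connected claw-free graph on `n` vertices with all degrees at least `3` and
nonnegative vertex weights has a spanning tree whose internal weight is at least
`(3/5 - 1/n)` times the total weight. -/
theorem clawfree_spanning_tree_internal_weight
    {V : Type*} [Fintype V] (G : SimpleGraph V)
    (hconn : G.Connected) (hcf : ClawFree G) (hdeg : ∀ v : V, 3 ≤ G.degree v)
    (w : V → ℝ) (hw : ∀ v : V, 0 ≤ w v) :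
    ∃ T : SimpleGraph V, T ≤ G ∧ T.IsTree ∧
      (3 / 5 - 1 / (Fintype.card V : ℝ)) * (∑ v : V, w v) ≤ internalWeight T w := by
  obtain ⟨T, K, O⟩ := ClawTree.exists_opt hconn hcf hdeg hw
  refine ⟨T, O.le, O.tree, ?_⟩
  have hW : 0 ≤ ∑ v, w v := Finset.sum_nonneg fun v _ => hw v
  have hi : internalWeight T w = ∑ v, (if 2 ≤ T.degree v then w v else 0) := by
    unfold internalWeight
    rw [Finset.sum_filter]
  have hsplit : ∑ v, w v = ∑ v, (if T.degree v < 2 then w v else 0) +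
      ∑ v, (if 2 ≤ T.degree v then w v else 0) := by
    rw [← Finset.sum_add_distrib]
    refine Finset.sum_congr rfl fun v _ => ?_
    split_ifs <;> first | (exfalso; omega) | simp
  have hne := hconn.nonempty
  have hn : 3 ≤ Fintype.card V := by
    obtain ⟨v⟩ := hne
    have := G.degree_lt_card_verts v
    have := hdeg v
    omega
  have hn' : (3 : ℝ) ≤ Fintype.card V := by exact_mod_cast hn
  set n : ℝ := (Fintype.card V : ℝ)
  have hn0 : 0 < n := by linarith
  by_cases ind : ∀ l l', T.degree l < 2 → T.degree l' < 2 → ¬ G.Adj l l'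
  · have h := ClawTree.charging O ind
    have h1 : 0 ≤ 1 / n * ∑ v, w v := mul_nonneg (by positivity) hW
    rw [hi, sub_mul]
    linarith
  · push Not at ind
    obtain ⟨l, l', hl, hl', hadj⟩ := ind
    obtain ⟨h1, h2⟩ := ClawTree.ham O hl hl' hadj
    have h3 : ∑ v, (if T.degree v < 2 then w v else 0) ≤ w l + w l' := by
      rw [← Finset.sum_filter, ← Finset.sum_pair hadj.ne]
      refine Finset.sum_le_sum_of_subset_of_nonneg ?_ (fun i _ _ => hw i)
      intro k hk
      rw [Finset.mem_filter] at hk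
      simpa using h1 k hk.2
    rw [hi]
    set W := ∑ v, w v
    have h4 : w l + w l' ≤ 2 * (1 / n * W) := by
      have : w l + w l' ≤ (2 * W) / n := by
        rw [le_div_iff₀ hn0]; linarith
      calc _ ≤ _ := this
        _ = _ := by ring
    have h5 : 1 / n * W ≤ 1 / 3 * W := by
      apply mul_le_mul_of_nonneg_right _ hW
      exact one_div_le_one_div_of_le (by norm_num) hn'
    rw [sub_mul]
    linarith
end
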